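/- arXiv:2405.13772 — 4 statements merged into one kernel-verified Lean document; each statement's English description precedes it below -/
import Mathlib

section
/- Let (T,p) ∈ 𝒯_G and let J and K be disjoint minimum cardinality (T,p)-joins. If the set C = J ∪ K has an even-chord, then J and K are equivalent (J ∼ K). -/
open MvPolynomial Finset

variable {n : ℕ}

/-- The monomial `x_i * x_j` attached to an edge `{i,j}`. -/
noncomputable def edgeMono (K : Type*) [Field K] (e : Sym2 (Fin n)) :
    MvPolynomial (Fin n) K :=
  Sym2.lift ⟨fun i j => X i * X j, fun _ _ => mul_comm _ _⟩ e

/-- The map `φ : K[E_G] → K[x_1,…,x_n]`, `t_e ↦ x_i x_j` for `e = {i,j}`. -/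
noncomputable def phiG (K : Type*) [Field K] (G : SimpleGraph (Fin n)) :
    MvPolynomial G.edgeSet K →ₐ[K] MvPolynomial (Fin n) K :=
  aeval (fun e => edgeMono K e.1)

/-- The Eulerian ideal `I(G) = φ⁻¹(x_i² - x_j² : i, j)`. -/
noncomputable def eulerianIdeal (K : Type*) [Field K] (G : SimpleGraph (Fin n)) :
    Ideal (MvPolynomial G.edgeSet K) :=
  Ideal.comap (phiG K G) (Ideal.span {f | ∃ i j : Fin n, f = X i ^ 2 - X j ^ 2})

/-- `deg_J(i)`: the number of edges of `J` containing the vertex `i`. -/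
def degIn (G : SimpleGraph (Fin n)) (J : Finset G.edgeSet) (i : Fin n) : ℕ :=
  (J.filter fun e => i ∈ e.val).card

/-- A set of edges is Eulerian if every vertex has even degree in it. -/
def IsEulerianSet (G : SimpleGraph (Fin n)) (C : Finset G.edgeSet) : Prop :=
  ∀ i : Fin n, Even (degIn G C i)

/-- `J` is a `T`-join. -/
def IsTJoin (G : SimpleGraph (Fin n)) (T : Finset (Fin n)) (J : Finset G.edgeSet) : Prop :=
  ∀ i : Fin n, i ∈ T ↔ Odd (degIn G J i)

/-- `J` is a `(T,p)`-join. -/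
def IsTPJoin (G : SimpleGraph (Fin n)) (T : Finset (Fin n)) (p : ZMod 2)
    (J : Finset G.edgeSet) : Prop :=
  IsTJoin G T J ∧ (J.card : ZMod 2) = p

/-- `(T,p) ∈ 𝒯_G`: there exists a `(T,p)`-join. -/
def JoinExists (G : SimpleGraph (Fin n)) (T : Finset (Fin n)) (p : ZMod 2) : Prop :=
  ∃ J : Finset G.edgeSet, IsTPJoin G T p J

/-- `J ∈ 𝒥(T,p)`: `J` is a `(T,p)`-join of minimum cardinality. -/
def IsMinJoin (G : SimpleGraph (Fin n)) (T : Finset (Fin n)) (p : ZMod 2)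
    (J : Finset G.edgeSet) : Prop :=
  IsTPJoin G T p J ∧ ∀ J' : Finset G.edgeSet, IsTPJoin G T p J' → J.card ≤ J'.card

/-- The equivalence relation `∼` on minimum cardinality `(T,p)`-joins. -/
def JoinEquiv (G : SimpleGraph (Fin n)) (T : Finset (Fin n)) (p : ZMod 2)
    (J K : Finset G.edgeSet) : Prop :=
  ∃ (r : ℕ) (L : ℕ → Finset G.edgeSet), L 0 = J ∧ L r = K ∧
    (∀ i ≤ r, IsMinJoin G T p (L i)) ∧ ∀ i < r, (L i ∩ L (i + 1)).Nonempty

/-- `(T,p) ∈ 𝒯_G*`: there are two nonequivalent minimum cardinality `(T,p)`-joins. -/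
def TGstar (G : SimpleGraph (Fin n)) (T : Finset (Fin n)) (p : ZMod 2) : Prop :=
  ∃ J K : Finset G.edgeSet, IsMinJoin G T p J ∧ IsMinJoin G T p K ∧ ¬ JoinEquiv G T p J K

/-- `t_J`, the product of the variables indexed by the edges of `J`. -/
noncomputable def tMon (K : Type*) [Field K] (G : SimpleGraph (Fin n))
    (J : Finset G.edgeSet) : MvPolynomial G.edgeSet K :=
  ∏ e ∈ J, X e

/-- The vertex set of a set of edges. -/
def edgeVerts (G : SimpleGraph (Fin n)) (C : Finset G.edgeSet) : Finset (Fin n) :=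
  Finset.univ.filter fun i => ∃ e ∈ C, i ∈ e.val

/-- `C` is the edge set of a cycle of `G`. -/
def IsCycleSet (G : SimpleGraph (Fin n)) (C : Finset G.edgeSet) : Prop :=
  ∃ (v : Fin n) (w : G.Walk v v), w.IsCycle ∧
    C.image (fun e => e.val) = w.edges.toFinset

/-- A chord of a cycle `C`: an edge of `G` joining two nonadjacent vertices of `C`. -/
def IsChord (G : SimpleGraph (Fin n)) (C : Finset G.edgeSet) (l : G.edgeSet) : Prop :=
  l ∉ C ∧ ∀ i ∈ l.val, i ∈ edgeVerts G C

/-- An even-chord of an even cardinality Eulerian set `C`. -/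
def IsEvenChord (G : SimpleGraph (Fin n)) (C : Finset G.edgeSet) (l : G.edgeSet) : Prop :=
  l ∉ C ∧ ∃ C₁ C₂ : Finset G.edgeSet,
    IsEulerianSet G C₁ ∧ Even C₁.card ∧ IsEulerianSet G C₂ ∧ Even C₂.card ∧
    C₁ ∩ C₂ = {l} ∧ C = symmDiff C₁ C₂

/-- `S` is a minimal homogeneous generating set of the ideal `I`. -/
def IsMinimalHomGenSet {σ K : Type*} [Field K] (S : Set (MvPolynomial σ K))
    (I : Ideal (MvPolynomial σ K)) : Prop :=
  (∀ f ∈ S, ∃ d : ℕ, f.IsHomogeneous d) ∧ Ideal.span S = I ∧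
    ∀ f ∈ S, Ideal.span (S \ {f}) ≠ I


theorem Finset.card_symmDiff_add {α : Type*} [DecidableEq α] (A B : Finset α) :
    (symmDiff A B).card + 2 * (A ∩ B).card = A.card + B.card := by
  have h : symmDiff A B = (A ∪ B) \ (A ∩ B) := symmDiff_eq_sup_sdiff_inf A B
  have h1 := Finset.card_sdiff_add_card_eq_card
    (Finset.inter_subset_left.trans Finset.subset_union_left : A ∩ B ⊆ A ∪ B)
  have h2 := Finset.card_union_add_card_inter A B
  rw [h]
  omega

theorem degIn_symmDiff_add (G : SimpleGraph (Fin n)) (A B : Finset G.edgeSet) (i : Fin n) :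
    degIn G (symmDiff A B) i + 2 * degIn G (A ∩ B) i = degIn G A i + degIn G B i := by
  have h := Finset.card_symmDiff_add (A.filter fun e => i ∈ e.val) (B.filter fun e => i ∈ e.val)
  have h1 : (symmDiff A B).filter (fun e => i ∈ e.val) =
      symmDiff (A.filter fun e => i ∈ e.val) (B.filter fun e => i ∈ e.val) := by
    ext e
    simp only [Finset.mem_filter, Finset.mem_symmDiff]
    tauto
  unfold degIn
  rw [h1, Finset.filter_inter_distrib]
  exact h

/-- Switching along an Eulerian set of even cardinality preserves `(T,p)`-joins. -/
theorem IsTPJoin.symmDiff {G : SimpleGraph (Fin n)} {T : Finset (Fin n)} {p : ZMod 2}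
    {J C : Finset G.edgeSet} (hJ : IsTPJoin G T p J) (hC : IsEulerianSet G C)
    (hCc : Even C.card) : IsTPJoin G T p (symmDiff J C) := by
  refine ⟨fun i => ?_, ?_⟩
  · have h := degIn_symmDiff_add G J C i
    have h2 := hC i
    rw [hJ.1 i]
    grind
  · rw [← hJ.2, ZMod.natCast_eq_natCast_iff]
    have h := Finset.card_symmDiff_add J C
    obtain ⟨k, hk⟩ := hCc
    unfold Nat.ModEq
    omega

theorem IsMinJoin.two_mul_card_inter_le {G : SimpleGraph (Fin n)} {T : Finset (Fin n)}
    {p : ZMod 2} {J C : Finset G.edgeSet} (hJ : IsMinJoin G T p J) (hC : IsEulerianSet G C)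
    (hCc : Even C.card) : 2 * (J ∩ C).card ≤ C.card := by
  have h := hJ.2 _ (hJ.1.symmDiff hC hCc)
  have h2 := Finset.card_symmDiff_add J C
  omega

theorem IsMinJoin.symmDiff {G : SimpleGraph (Fin n)} {T : Finset (Fin n)} {p : ZMod 2}
    {J C : Finset G.edgeSet} (hJ : IsMinJoin G T p J) (hC : IsEulerianSet G C)
    (hCc : Even C.card) (h : 2 * (J ∩ C).card = C.card) :
    IsMinJoin G T p (symmDiff J C) := by
  refine ⟨hJ.1.symmDiff hC hCc, fun J' hJ' => ?_⟩
  have h1 := hJ.2 J' hJ'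
  have h2 := Finset.card_symmDiff_add J C
  omega

/-- In a simple graph no Eulerian set consists of exactly two edges. -/
theorem IsEulerianSet.card_ne_two {G : SimpleGraph (Fin n)} {C : Finset G.edgeSet}
    (hC : IsEulerianSet G C) : C.card ≠ 2 := by
  intro h
  obtain ⟨a, b, hab, rfl⟩ := Finset.card_eq_two.1 h
  refine hab (Subtype.ext (Sym2.ext fun i => ?_))
  have hi := hC i
  unfold degIn at hi
  by_cases ha : i ∈ a.val <;> by_cases hb : i ∈ b.val <;>
    simp_all [Finset.filter_insert, Finset.filter_singleton]

theorem JoinEquiv.of_inter_nonempty {G : SimpleGraph (Fin n)} {T : Finset (Fin n)} {p : ZMod 2}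
    {J L K : Finset G.edgeSet} (hJ : IsMinJoin G T p J) (hL : IsMinJoin G T p L)
    (hK : IsMinJoin G T p K) (hJL : (J ∩ L).Nonempty) (hLK : (L ∩ K).Nonempty) :
    JoinEquiv G T p J K := by
  refine ⟨2, fun i => if i = 0 then J else if i = 1 then L else K, rfl, rfl, ?_, ?_⟩
  · intro i hi
    interval_cases i <;> simpa
  · intro i hi
    interval_cases i <;> simpa

theorem joinEquiv_of_two_mul_card_inter_eq {G : SimpleGraph (Fin n)} {T : Finset (Fin n)}
    {p : ZMod 2} {J K C₁ C₂ : Finset G.edgeSet} {l : G.edgeSet}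
    (hJ : IsMinJoin G T p J) (hK : IsMinJoin G T p K) (hdisj : Disjoint J K) (hl : l ∉ J)
    (hC₁ : IsEulerianSet G C₁) (hC₁c : Even C₁.card) (hC₂ : IsEulerianSet G C₂)
    (hinter : C₁ ∩ C₂ = {l})
    (hKC₁ : (K ∩ C₁).card + (J ∩ C₁).card + 1 = C₁.card)
    (hJC₂ : 2 * (J ∩ C₂).card + 2 = C₂.card) (h : 2 * (J ∩ C₁).card = C₁.card) :
    JoinEquiv G T p J K := by
  have hmem (e) : e ∈ C₁ ∧ e ∈ C₂ ↔ e = l := by rw [← Finset.mem_inter, hinter]; simp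
  have h1 : (K ∩ C₁).Nonempty := by
    rw [← Finset.card_pos]
    have := hC₁.card_ne_two
    omega
  have h2 : (J ∩ C₂).Nonempty := by
    rw [← Finset.card_pos]
    have := hC₂.card_ne_two
    omega
  refine .of_inter_nonempty hJ (hJ.symmDiff hC₁ hC₁c h) hK (h2.mono fun e he => ?_)
    (h1.mono fun e he => ?_)
  · have hel : e ≠ l := by rintro rfl; simp_all
    have := hmem e
    simp only [Finset.mem_inter, Finset.mem_symmDiff] at he ⊢
    tauto
  · have : e ∈ J → e ∉ K := fun hj => Finset.disjoint_left.1 hdisj hj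
    simp only [Finset.mem_inter, Finset.mem_symmDiff] at he ⊢
    tauto

theorem card_inter_add_card_inter_add_one {α : Type*} [DecidableEq α] {J K C₁ C₂ : Finset α}
    {l : α} (hdisj : Disjoint J K) (hl : l ∉ J ∪ K) (hinter : C₁ ∩ C₂ = {l})
    (hunion : J ∪ K = symmDiff C₁ C₂) :
    (K ∩ C₁).card + (J ∩ C₁).card + 1 = C₁.card := by
  have hmem (e) : e ∈ C₁ ∧ e ∈ C₂ ↔ e = l := by rw [← Finset.mem_inter, hinter]; simp
  have hC : insert l ((K ∩ C₁) ∪ (J ∩ C₁)) = C₁ := by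
    ext e
    have h1 := hmem e
    have h2 : e ∈ J ∪ K ↔ e ∈ symmDiff C₁ C₂ := by rw [hunion]
    simp only [Finset.mem_insert, Finset.mem_union, Finset.mem_inter,
      Finset.mem_symmDiff] at h2 ⊢
    tauto
  have hd : Disjoint (K ∩ C₁) (J ∩ C₁) :=
    hdisj.symm.mono Finset.inter_subset_left Finset.inter_subset_left
  conv_rhs => rw [← hC]
  rw [Finset.card_insert_of_notMem (by simp at hl ⊢; tauto), Finset.card_union_of_disjoint hd]

theorem card_eq_card_inter_add_card_inter {α : Type*} [DecidableEq α] {J C₁ C₂ : Finset α}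
    {l : α} (hl : l ∉ J) (hinter : C₁ ∩ C₂ = {l}) (hsub : J ⊆ C₁ ∪ C₂) :
    J.card = (J ∩ C₁).card + (J ∩ C₂).card := by
  have hd : Disjoint (J ∩ C₁) (J ∩ C₂) := by
    rw [Finset.disjoint_iff_inter_eq_empty, ← Finset.inter_inter_distrib_left, hinter]
    exact Finset.inter_singleton_of_notMem hl
  rw [← Finset.card_union_of_disjoint hd, ← Finset.inter_union_distrib_left,
    Finset.inter_eq_left.2 hsub]

/-- if `J` and `K` are disjoint minimum cardinality `(T,p)`-joins and
`C = J ∪ K` has an even-chord, then `J ∼ K`. -/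
theorem stmt8 {n : ℕ} (G : SimpleGraph (Fin n)) (hE : 2 ≤ G.edgeSet.ncard)
    (T : Finset (Fin n)) (p : ZMod 2)
    (J K' : Finset G.edgeSet) (hJ : IsMinJoin G T p J) (hK : IsMinJoin G T p K')
    (hdisj : Disjoint J K') (l : G.edgeSet) (hl : IsEvenChord G (J ∪ K') l) :
    JoinEquiv G T p J K' := by
  obtain ⟨hlC, C₁, C₂, hC₁, hC₁c, hC₂, hC₂c, hinter, hunion⟩ := hl
  have hsub : J ∪ K' ⊆ C₁ ∪ C₂ := hunion ▸ symmDiff_le_sup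
  have hlJ : l ∉ J := fun h => hlC (Finset.mem_union_left _ h)
  have hlK : l ∉ K' := fun h => hlC (Finset.mem_union_right _ h)
  have hinter' : C₂ ∩ C₁ = {l} := by rw [Finset.inter_comm, hinter]
  have c1 := card_inter_add_card_inter_add_one hdisj hlC hinter hunion
  have c2 := card_inter_add_card_inter_add_one hdisj hlC hinter' (symmDiff_comm C₁ C₂ ▸ hunion)
  have cJ := card_eq_card_inter_add_card_inter hlJ hinter (Finset.union_subset_left hsub)
  have cK := card_eq_card_inter_add_card_inter hlK hinter (Finset.union_subset_right hsub)
  have hJK : J.card = K'.card := le_antisymm (hJ.2 _ hK.1) (hK.2 _ hJ.1)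
  have i1 := hJ.two_mul_card_inter_le hC₁ hC₁c
  have i2 := hJ.two_mul_card_inter_le hC₂ hC₂c
  have i3 := hK.two_mul_card_inter_le hC₁ hC₁c
  have i4 := hK.two_mul_card_inter_le hC₂ hC₂c
  have e1 := hC₁c.two_dvd
  have e2 := hC₂c.two_dvd
  by_cases h : 2 * (J ∩ C₁).card = C₁.card
  · exact joinEquiv_of_two_mul_card_inter_eq hJ hK hdisj hlJ hC₁ hC₁c hC₂ hinter c1 (by omega) h
  · exact joinEquiv_of_two_mul_card_inter_eq hJ hK hdisj hlJ hC₂ hC₂c hC₁ hinter' c2 (by omega)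
      (by omega)
end

section
/- If G is the complete graph on n ≥ 3 vertices, then the maximal generating degree of the Eulerian ideal satisfies d(I(G)) = 2; that is, I(G) is generated by its elements of degree 2. -/
open MvPolynomial Finset

variable {n : ℕ}

section Combinatorics

variable {V : Type*}

/-- The edge of the complete graph joining two distinct vertices. -/
def topEdge {i j : V} (h : i ≠ j) : (⊤ : SimpleGraph V).edgeSet :=
  ⟨s(i, j), by simpa using h⟩

lemma topEdge_comm {i j : V} (h : i ≠ j) : topEdge h = topEdge h.symm :=
  Subtype.ext Sym2.eq_swap

lemma exists_eq_topEdge {v : V} {e : (⊤ : SimpleGraph V).edgeSet} (h : v ∈ e.1) :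
    ∃ (b : V) (hb : v ≠ b), e = topEdge hb := by
  obtain ⟨b, hb⟩ := h
  have he := e.2
  rw [hb] at he
  exact ⟨b, by simpa using he, Subtype.ext hb⟩

lemma exists_topEdge (e : (⊤ : SimpleGraph V).edgeSet) :
    ∃ (a b : V) (hb : a ≠ b), e = topEdge hb := by
  obtain ⟨e, he⟩ := e
  induction e with
  | h a b => exact ⟨a, b, by simpa using he, rfl⟩

@[simp] lemma mem_topEdge {i j v : V} (h : i ≠ j) : v ∈ (topEdge h).1 ↔ v = i ∨ v = j :=
  Sym2.mem_iff

variable [DecidableEq V]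

/-- The indicator vector modulo `2` of the endpoints of an edge. -/
def edgeParity (e : (⊤ : SimpleGraph V).edgeSet) : V → ZMod 2 :=
  fun v => if v ∈ e.1 then 1 else 0

/-- The vector of vertex degrees modulo `2` of a multiset of edges. -/
def parity (P : Multiset (⊤ : SimpleGraph V).edgeSet) : V → ZMod 2 :=
  (P.map edgeParity).sum

lemma parity_cons (e : (⊤ : SimpleGraph V).edgeSet) (P : Multiset (⊤ : SimpleGraph V).edgeSet) :
    parity (e ::ₘ P) = edgeParity e + parity P := by
  simp [parity]

lemma edgeParity_star_add {a b c d : V} (hab : a ≠ b) (hac : a ≠ c) (hdb : d ≠ b) (hdc : d ≠ c) :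
    edgeParity (topEdge hab) + edgeParity (topEdge hac) =
      edgeParity (topEdge hdb) + edgeParity (topEdge hdc) := by
  funext v
  simp only [edgeParity, Pi.add_apply, mem_topEdge]
  by_cases h1 : v = a <;> by_cases h2 : v = b <;> by_cases h3 : v = c <;> by_cases h4 : v = d <;>
    simp_all <;> decide

lemma edgeParity_swap_add {a b c d : V} (hab : a ≠ b) (hcd : c ≠ d) (hac : a ≠ c) (hbd : b ≠ d) :
    edgeParity (topEdge hab) + edgeParity (topEdge hcd) =
      edgeParity (topEdge hac) + edgeParity (topEdge hbd) := by
  funext v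
  simp only [edgeParity, Pi.add_apply, mem_topEdge]
  by_cases h1 : v = a <;> by_cases h2 : v = b <;> by_cases h3 : v = c <;> by_cases h4 : v = d <;>
    simp_all

lemma exists_mem_of_parity_ne_zero {P : Multiset (⊤ : SimpleGraph V).edgeSet} {v : V}
    (h : parity P v ≠ 0) : ∃ e ∈ P, v ∈ e.1 := by
  induction P using Multiset.induction_on with
  | empty => simp [parity] at h
  | cons e P ih =>
    by_cases hv : v ∈ e.1
    · exact ⟨e, by simp, hv⟩
    · rw [parity_cons, Pi.add_apply, edgeParity, if_neg hv, zero_add] at h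
      obtain ⟨f, hf, hvf⟩ := ih h
      exact ⟨f, Multiset.mem_cons_of_mem hf, hvf⟩

lemma sum_parity [Fintype V] (P : Multiset (⊤ : SimpleGraph V).edgeSet) :
    ∑ v, parity P v = 0 := by
  induction P using Multiset.induction_on with
  | empty => simp [parity]
  | cons e P ih =>
    obtain ⟨a, b, hab, rfl⟩ := exists_topEdge e
    have : (univ.filter fun v => v = a ∨ v = b) = {a, b} := by ext; simp
    simp only [parity_cons, Pi.add_apply, sum_add_distrib, ih, add_zero, edgeParity, mem_topEdge,
      sum_boole, this, card_pair hab]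
    decide

lemma exists_ne_parity_ne_zero [Fintype V] {P : Multiset (⊤ : SimpleGraph V).edgeSet} {i : V}
    (h : parity P i ≠ 0) : ∃ j, i ≠ j ∧ parity P j ≠ 0 := by
  by_contra! H
  apply h
  rw [← sum_parity P, Finset.sum_eq_single i (fun j _ hj => H j hj.symm) (by simp)]

variable {M : Type*} [CommMonoid M]

/-- Two multisets of edges have the same size, the same degree parities and the same
product of weights. -/
def SameWeight (τ : (⊤ : SimpleGraph V).edgeSet → M)
    (P Q : Multiset (⊤ : SimpleGraph V).edgeSet) : Prop :=
  P.card = Q.card ∧ parity P = parity Q ∧ (P.map τ).prod = (Q.map τ).prod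

/-- The weight of a pair of edges depends only on its degree parities. -/
def IsQuadratic (τ : (⊤ : SimpleGraph V).edgeSet → M) : Prop :=
  ∀ e f g h, edgeParity e + edgeParity f = edgeParity g + edgeParity h → τ e * τ f = τ g * τ h

variable {τ : (⊤ : SimpleGraph V).edgeSet → M} {P Q R : Multiset (⊤ : SimpleGraph V).edgeSet}

lemma SameWeight.refl (P : Multiset (⊤ : SimpleGraph V).edgeSet) : SameWeight τ P P :=
  ⟨rfl, rfl, rfl⟩

lemma SameWeight.trans (h₁ : SameWeight τ P Q) (h₂ : SameWeight τ Q R) : SameWeight τ P R :=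
  ⟨h₁.1.trans h₂.1, h₁.2.1.trans h₂.2.1, h₁.2.2.trans h₂.2.2⟩

lemma IsQuadratic.sameWeight (hτ : IsQuadratic τ) {e f g h : (⊤ : SimpleGraph V).edgeSet}
    (H : edgeParity e + edgeParity f = edgeParity g + edgeParity h) :
    SameWeight τ (e ::ₘ f ::ₘ R) (g ::ₘ h ::ₘ R) := by
  refine ⟨by simp, ?_, ?_⟩
  · simp only [parity_cons, ← add_assoc, H]
  · simp only [Multiset.map_cons, Multiset.prod_cons, ← mul_assoc, hτ _ _ _ _ H]

lemma exists_sameWeight_cons_of_mem {e : (⊤ : SimpleGraph V).edgeSet} (h : e ∈ P) :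
    ∃ R, SameWeight τ P (e ::ₘ R) := by
  obtain ⟨R, rfl⟩ := Multiset.exists_cons_of_mem h
  exact ⟨R, .refl _⟩

lemma IsQuadratic.exists_cons_of_star (hτ : IsQuadratic τ) {a i k j : V}
    (hai : a ≠ i) (hak : a ≠ k) (hij : i ≠ j) (hkj : k ≠ j) :
    ∃ R', SameWeight τ (topEdge hai ::ₘ topEdge hak ::ₘ R) (topEdge hij ::ₘ R') := by
  refine ⟨topEdge hkj ::ₘ R, ?_⟩
  rw [topEdge_comm hij, topEdge_comm hkj]
  exact hτ.sameWeight (edgeParity_star_add _ _ _ _)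

lemma IsQuadratic.exists_cons_of_swap (hτ : IsQuadratic τ) {a b i j : V}
    (hia : i ≠ a) (hjb : j ≠ b) (hij : i ≠ j) (hab : a ≠ b) :
    ∃ R', SameWeight τ (topEdge hia ::ₘ topEdge hjb ::ₘ R) (topEdge hij ::ₘ R') :=
  ⟨topEdge hab ::ₘ R, hτ.sameWeight (edgeParity_swap_add _ _ _ _)⟩

lemma IsQuadratic.exists_cons_of_covered (hτ : IsQuadratic τ) (hP : 3 ≤ P.card) {i j : V}
    (hij : i ≠ j) (hi : ∃ e ∈ P, i ∈ e.1) (hj : ∃ e ∈ P, j ∈ e.1) :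
    ∃ R, SameWeight τ P (topEdge hij ::ₘ R) := by
  obtain ⟨e, heP, hie⟩ := hi
  obtain ⟨f, hfP, hjf⟩ := hj
  obtain ⟨a, hia, rfl⟩ := exists_eq_topEdge hie
  obtain ⟨b, hjb, rfl⟩ := exists_eq_topEdge hjf
  obtain ⟨P, rfl⟩ := Multiset.exists_cons_of_mem heP
  by_cases hne : topEdge hjb = topEdge hia
  · have hja : j ∈ (topEdge hia).1 := by rw [← hne]; simp
    obtain rfl : j = a := by simpa [hij.symm] using hja
    exact ⟨P, .refl _⟩
  replace hfP : topEdge hjb ∈ P := by simpa [hne] using hfP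
  obtain ⟨P, rfl⟩ := Multiset.exists_cons_of_mem hfP
  by_cases hab : a = b
  swap
  · exact hτ.exists_cons_of_swap hia hjb hij hab
  subst hab
  obtain ⟨g, hg⟩ : ∃ g, g ∈ P := Multiset.card_pos_iff_exists_mem.1 (by
    simp only [Multiset.card_cons] at hP; omega)
  obtain ⟨P, rfl⟩ := Multiset.exists_cons_of_mem hg
  by_cases hag : a ∈ g.1
  · obtain ⟨k, hak, rfl⟩ := exists_eq_topEdge hag
    by_cases hkj : k = j
    · subst hkj
      rw [Multiset.cons_swap, Multiset.cons_swap (topEdge hia), topEdge_comm hjb,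
        topEdge_comm hij]
      exact hτ.exists_cons_of_star _ _ _ hij.symm
    · rw [Multiset.cons_swap (topEdge hjb), topEdge_comm hia]
      exact hτ.exists_cons_of_star _ _ _ hkj
  by_cases hig : i ∈ g.1
  · obtain ⟨l, hil, rfl⟩ := exists_eq_topEdge hig
    rw [Multiset.cons_swap (topEdge hjb), Multiset.cons_swap (topEdge hia),
      Multiset.cons_swap (topEdge hia)]
    exact hτ.exists_cons_of_swap _ _ _ (by rintro rfl; simp at hag)
  by_cases hjg : j ∈ g.1
  · obtain ⟨l, hjl, rfl⟩ := exists_eq_topEdge hjg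
    rw [Multiset.cons_swap (topEdge hjb)]
    exact hτ.exists_cons_of_swap _ _ _ (by rintro rfl; simp at hag)
  obtain ⟨k, l, hkl, rfl⟩ := exists_topEdge g
  simp only [mem_topEdge, not_or] at hag hig hjg
  rw [Multiset.cons_swap (topEdge hjb), topEdge_comm hkl]
  have h₁ := hτ.sameWeight (R := topEdge hjb ::ₘ P)
    (edgeParity_swap_add hia hkl.symm hig.2 hag.1)
  rw [Multiset.cons_swap (topEdge hag.1)] at h₁
  obtain ⟨R, h₂⟩ := hτ.exists_cons_of_swap (R := topEdge hag.1 ::ₘ P) hig.2 hjb hij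
    (Ne.symm hag.2)
  exact ⟨R, h₁.trans h₂⟩

lemma exists_mem_of_parity_eq_zero {e : (⊤ : SimpleGraph V).edgeSet} {v : V}
    (h : parity (e ::ₘ P) = 0) (hv : v ∈ e.1) : ∃ f ∈ P, v ∈ f.1 := by
  apply exists_mem_of_parity_ne_zero
  intro h0
  have := congrFun h v
  simp [parity_cons, edgeParity, hv, h0] at this

lemma IsQuadratic.exists_cons_of_parity_eq_zero (hτ : IsQuadratic τ) (hP : 3 ≤ P.card)
    (h0 : parity P = 0) {i j : V} (hij : i ≠ j) :
    ∃ R, SameWeight τ P (topEdge hij ::ₘ R) := by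
  wlog hi : ∃ e ∈ P, i ∈ e.1 generalizing P
  · obtain ⟨e, he⟩ : ∃ e, e ∈ P := Multiset.card_pos_iff_exists_mem.1 (by omega)
    obtain ⟨a, b, hab, rfl⟩ := exists_topEdge e
    obtain ⟨P, rfl⟩ := Multiset.exists_cons_of_mem he
    obtain ⟨f, hf, haf⟩ := exists_mem_of_parity_eq_zero h0 (v := a) (by simp)
    obtain ⟨c, hac, rfl⟩ := exists_eq_topEdge haf
    obtain ⟨P, rfl⟩ := Multiset.exists_cons_of_mem hf
    have hib : i ≠ b := by
      rintro rfl
      exact hi ⟨topEdge hab, by simp, by simp⟩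
    have hic : i ≠ c := by
      rintro rfl
      exact hi ⟨topEdge hac, by simp, by simp⟩
    have h₁ := hτ.sameWeight (R := P) (edgeParity_star_add hab hac hib hic)
    obtain ⟨R, h₂⟩ := this (h₁.1 ▸ hP) (h₁.2.1 ▸ h0) ⟨topEdge hib, by simp, by simp⟩
    exact ⟨R, h₁.trans h₂⟩
  by_cases hj : ∃ e ∈ P, j ∈ e.1
  · exact hτ.exists_cons_of_covered hP hij hi hj
  obtain ⟨e, he, hie⟩ := hi
  obtain ⟨b, hib, rfl⟩ := exists_eq_topEdge hie
  obtain ⟨P, rfl⟩ := Multiset.exists_cons_of_mem he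
  obtain ⟨f, hf, hbf⟩ := exists_mem_of_parity_eq_zero h0 (v := b) (by simp)
  obtain ⟨x, hbx, rfl⟩ := exists_eq_topEdge hbf
  obtain ⟨P, rfl⟩ := Multiset.exists_cons_of_mem hf
  rw [topEdge_comm hib]
  refine hτ.exists_cons_of_star _ _ _ ?_
  rintro rfl
  exact hj ⟨topEdge hbx, by simp, by simp⟩

lemma eq_of_parity_eq_of_card_lt_two (hP : P.card < 2) (hc : P.card = Q.card)
    (hp : parity P = parity Q) : P = Q := by
  rcases Nat.le_one_iff_eq_zero_or_eq_one.1 (Nat.lt_succ_iff.1 hP) with h | h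
  · rw [h, eq_comm, Multiset.card_eq_zero] at hc
    rw [Multiset.card_eq_zero] at h
    rw [h, hc]
  · rw [h, eq_comm, Multiset.card_eq_one] at hc
    rw [Multiset.card_eq_one] at h
    obtain ⟨e, rfl⟩ := h
    obtain ⟨f, rfl⟩ := hc
    have hef : e = f := by
      ext v
      have := congrFun hp v
      simp only [parity, Multiset.map_singleton, Multiset.sum_singleton, edgeParity] at this
      by_cases h1 : v ∈ e.1 <;> by_cases h2 : v ∈ f.1 <;> simp_all
    rw [hef]

/-- The weight of a multiset of edges depends only on its size and its degree parities. -/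
lemma IsQuadratic.prod_map_eq [Fintype V] (hτ : IsQuadratic τ)
    (hc : P.card = Q.card) (hp : parity P = parity Q) :
    (P.map τ).prod = (Q.map τ).prod := by
  induction hm : P.card using Nat.strong_induction_on generalizing P Q with
  | _ m ih =>
  by_cases hm2 : m < 2
  · rw [eq_of_parity_eq_of_card_lt_two (hm ▸ hm2) hc hp]
  by_cases hm3 : m = 2
  · subst hm3
    rw [hm, eq_comm, Multiset.card_eq_two] at hc
    rw [Multiset.card_eq_two] at hm
    obtain ⟨e, f, rfl⟩ := hm
    obtain ⟨g, h, rfl⟩ := hc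
    simpa using hτ e f g h (by simpa [parity] using hp)
  obtain ⟨e, ⟨P', hP⟩, Q', hQ⟩ : ∃ e, (∃ P', SameWeight τ P (e ::ₘ P')) ∧
      ∃ Q', SameWeight τ Q (e ::ₘ Q') := by
    by_cases h0 : parity P = 0
    · obtain ⟨e, he⟩ : ∃ e, e ∈ Q := Multiset.card_pos_iff_exists_mem.1 (by omega)
      obtain ⟨a, b, hab, rfl⟩ := exists_topEdge e
      exact ⟨_, hτ.exists_cons_of_parity_eq_zero (by omega) h0 hab,
        exists_sameWeight_cons_of_mem he⟩
    · obtain ⟨i, hi⟩ := Function.ne_iff.1 h0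
      obtain ⟨j, hij, hj⟩ := exists_ne_parity_ne_zero hi
      exact ⟨topEdge hij,
        hτ.exists_cons_of_covered (by omega) hij (exists_mem_of_parity_ne_zero hi)
          (exists_mem_of_parity_ne_zero hj),
        hτ.exists_cons_of_covered (by omega) hij (exists_mem_of_parity_ne_zero (hp ▸ hi))
          (exists_mem_of_parity_ne_zero (hp ▸ hj))⟩
  have h1 := hP.1
  have h2 := hQ.1
  have h3 := hP.2.1
  have h4 := hQ.2.1
  simp only [Multiset.card_cons] at h1 h2
  rw [parity_cons] at h3 h4
  rw [hP.2.2, hQ.2.2, Multiset.map_cons, Multiset.map_cons, Multiset.prod_cons,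
    Multiset.prod_cons, ih P'.card (by omega) (by omega)
      (add_left_cancel (h3.symm.trans (hp.trans h4))) rfl]

end Combinatorics

section Algebra

/-- If all squares `y i ^ 2` agree, then a monomial in the `y i` depends only on its degree and
the parities of its exponents. -/
lemma prod_pow_eq_of_sq_eq {V A : Type*} [Fintype V] [CommMonoid A] {y : V → A}
    (hy : ∀ i j, y i ^ 2 = y j ^ 2) {a b : V → ℕ} (hs : ∑ v, a v = ∑ v, b v)
    (hp : ∀ v, a v % 2 = b v % 2) : ∏ v, y v ^ a v = ∏ v, y v ^ b v := by
  rcases isEmpty_or_nonempty V with h | ⟨⟨o⟩⟩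
  · simp
  have key : ∀ c : V → ℕ,
      ∏ v, y v ^ c v = (∏ v, y v ^ (c v % 2)) * (y o ^ 2) ^ (∑ v, c v / 2) := by
    intro c
    rw [← Finset.prod_pow_eq_pow_sum, ← Finset.prod_mul_distrib]
    refine Finset.prod_congr rfl fun v _ => ?_
    rw [hy o v, ← pow_mul, ← pow_add, Nat.mod_add_div]
  have hdiv : ∑ v, a v / 2 = ∑ v, b v / 2 := by
    have h : ∀ c : V → ℕ, ∑ v, c v = ∑ v, c v % 2 + 2 * ∑ v, c v / 2 := by
      intro c
      rw [Finset.mul_sum, ← Finset.sum_add_distrib]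
      exact Finset.sum_congr rfl fun v _ => (Nat.mod_add_div _ _).symm
    have ha := h a
    have hb := h b
    simp only [hp] at ha
    omega
  rw [key a, key b, hdiv]
  simp only [hp]

lemma edgeMono_eq_prod (K : Type*) [Field K] (e : (⊤ : SimpleGraph (Fin n)).edgeSet) :
    edgeMono K e.1 = ∏ v, (X v : MvPolynomial (Fin n) K) ^ (if v ∈ e.1 then 1 else 0) := by
  obtain ⟨a, b, hab, rfl⟩ := exists_topEdge e
  have : (univ.filter fun v => v = a ∨ v = b) = {a, b} := by ext; simp
  simp only [pow_ite, pow_one, pow_zero, mem_topEdge, ← Finset.prod_filter, this,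
    Finset.prod_pair hab]
  rfl

lemma sum_mem_edge (e : (⊤ : SimpleGraph (Fin n)).edgeSet) :
    (∑ v, if v ∈ e.1 then 1 else 0) = 2 := by
  obtain ⟨a, b, hab, rfl⟩ := exists_topEdge e
  have : (univ.filter fun v => v = a ∨ v = b) = {a, b} := by ext; simp
  simp only [mem_topEdge, sum_boole, this, card_pair hab]
  rfl

lemma X_mul_X_sub_mem_eulerianIdeal (K : Type*) [Field K]
    {e f g h : (⊤ : SimpleGraph (Fin n)).edgeSet}
    (H : edgeParity e + edgeParity f = edgeParity g + edgeParity h) :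
    X e * X f - X g * X h ∈ eulerianIdeal K (⊤ : SimpleGraph (Fin n)) := by
  rw [eulerianIdeal, Ideal.mem_comap, map_sub, ← Ideal.Quotient.mk_eq_mk_iff_sub_mem]
  simp only [map_mul, phiG, aeval_X, edgeMono_eq_prod, ← Finset.prod_mul_distrib, ← pow_add,
    map_prod, map_pow]
  apply prod_pow_eq_of_sq_eq
  · intro i j
    rw [← map_pow, ← map_pow, Ideal.Quotient.mk_eq_mk_iff_sub_mem]
    exact Ideal.subset_span ⟨i, j, rfl⟩
  · simp only [Finset.sum_add_distrib, sum_mem_edge]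
  · intro v
    have := congrFun H v
    simp only [edgeParity, Pi.add_apply] at this
    split_ifs at this ⊢ <;> revert this <;> decide

/-- The bidegree of a monomial in the edge variables: the degree of its image together with its
degree parities. -/
noncomputable def bidegree (a : (⊤ : SimpleGraph (Fin n)).edgeSet →₀ ℕ) :
    ℕ × (Fin n → ZMod 2) :=
  (2 * a.toMultiset.card, parity a.toMultiset)

/-- The monoid algebra quotient of the polynomial ring by the ideal of the `x_i² - x_j²`. -/
noncomputable def parityHom (K : Type*) [Field K] (n : ℕ) :
    MvPolynomial (Fin n) K →ₐ[K] AddMonoidAlgebra K (ℕ × (Fin n → ZMod 2)) :=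
  aeval fun i => AddMonoidAlgebra.single (1, Pi.single i 1) 1

lemma aeval_monomial_eq_toMultiset {σ K A : Type*} [Field K] [CommSemiring A] [Algebra K A]
    (θ : σ → A) (a : σ →₀ ℕ) (c : K) :
    aeval θ (monomial a c) = c • (a.toMultiset.map θ).prod := by
  rw [aeval_monomial, Algebra.smul_def]
  congr 1
  rw [Finsupp.toMultiset_map, Finsupp.prod_toMultiset, Finsupp.prod_mapDomain_index] <;>
    simp [pow_add]

lemma parityHom_comp_phiG (K : Type*) [Field K] :
    (parityHom K n).comp (phiG K ⊤) =
      aeval fun e => AddMonoidAlgebra.single (2, edgeParity e) 1 := by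
  ext1 e
  obtain ⟨a, b, hab, rfl⟩ := exists_topEdge e
  have hm : edgeMono K (topEdge hab).1 = X a * X b := rfl
  simp only [AlgHom.comp_apply, phiG, aeval_X, hm, map_mul, parityHom,
    AddMonoidAlgebra.single_mul_single, Prod.mk_add_mk, mul_one]
  congr 2
  funext v
  by_cases h1 : v = a
  · subst h1
    simp [edgeParity, hab]
  · by_cases h2 : v = b <;> simp [edgeParity, h1, h2, hab.symm]

lemma parityHom_phiG_monomial (K : Type*) [Field K]
    (a : (⊤ : SimpleGraph (Fin n)).edgeSet →₀ ℕ) (c : K) :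
    parityHom K n (phiG K ⊤ (monomial a c)) = AddMonoidAlgebra.single (bidegree a) c := by
  rw [← AlgHom.comp_apply, parityHom_comp_phiG, aeval_monomial_eq_toMultiset, bidegree]
  have : ∀ P : Multiset (⊤ : SimpleGraph (Fin n)).edgeSet,
      (P.map fun e => (AddMonoidAlgebra.single (2, edgeParity e) 1 :
        AddMonoidAlgebra K (ℕ × (Fin n → ZMod 2)))).prod =
      AddMonoidAlgebra.single (2 * P.card, parity P) 1 := by
    intro P
    induction P using Multiset.induction_on with
    | empty => rfl
    | cons e P ih =>
      simp only [Multiset.map_cons, Multiset.prod_cons, ih, AddMonoidAlgebra.single_mul_single,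
        Prod.mk_add_mk, mul_one, parity_cons, Multiset.card_cons]
      congr 2
      ring
  rw [this, AddMonoidAlgebra.smul_single, smul_eq_mul, mul_one]

lemma parityHom_phiG_eq_zero {K : Type*} [Field K]
    {f : MvPolynomial (⊤ : SimpleGraph (Fin n)).edgeSet K} (hf : f ∈ eulerianIdeal K ⊤) :
    parityHom K n (phiG K ⊤ f) = 0 := by
  suffices h : Ideal.span {f : MvPolynomial (Fin n) K | ∃ i j : Fin n, f = X i ^ 2 - X j ^ 2} ≤
      RingHom.ker (parityHom K n) from h hf
  rw [Ideal.span_le]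
  rintro _ ⟨i, j, rfl⟩
  have h : ∀ i : Fin n, (Pi.single i 1 + Pi.single i 1 : Fin n → ZMod 2) = 0 :=
    fun i => funext fun v => CharTwo.add_self_eq_zero _
  simp [parityHom, pow_two, AddMonoidAlgebra.single_mul_single, h]

/-- Linear relations satisfied by the coefficients of an element of the Eulerian ideal. -/
lemma sum_coeff_smul_bidegree_eq_zero {K W : Type*} [Field K] [AddCommGroup W] [Module K W]
    {f : MvPolynomial (⊤ : SimpleGraph (Fin n)).edgeSet K} (hf : f ∈ eulerianIdeal K ⊤)
    (F : ℕ × (Fin n → ZMod 2) → W) :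
    ∑ a ∈ f.support, coeff a f • F (bidegree a) = 0 := by
  have h := parityHom_phiG_eq_zero hf
  rw [f.as_sum] at h
  simp only [map_sum, parityHom_phiG_monomial] at h
  have h2 := congrArg (fun p => Finsupp.linearCombination K F p.coeff) h
  simpa using h2

lemma eulerianIdeal_eq_span (K : Type*) [Field K] :
    eulerianIdeal K (⊤ : SimpleGraph (Fin n)) =
      Ideal.span {f : MvPolynomial (⊤ : SimpleGraph (Fin n)).edgeSet K |
        f ∈ eulerianIdeal K (⊤ : SimpleGraph (Fin n)) ∧ f.IsHomogeneous 2} := by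
  refine le_antisymm ?_ (Ideal.span_le.2 fun f hf => hf.1)
  intro f hf
  set J := Ideal.span {f : MvPolynomial (⊤ : SimpleGraph (Fin n)).edgeSet K |
        f ∈ eulerianIdeal K (⊤ : SimpleGraph (Fin n)) ∧ f.IsHomogeneous 2}
  let τ : (⊤ : SimpleGraph (Fin n)).edgeSet →
      MvPolynomial (⊤ : SimpleGraph (Fin n)).edgeSet K ⧸ J :=
    fun e => Ideal.Quotient.mkₐ K J (X e)
  have hτ : IsQuadratic τ := by
    intro e f g h H
    simp only [τ, ← map_mul]
    rw [Ideal.Quotient.mkₐ_eq_mk, Ideal.Quotient.mk_eq_mk_iff_sub_mem]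
    exact Ideal.subset_span ⟨X_mul_X_sub_mem_eulerianIdeal K H,
      ((isHomogeneous_X _ _).mul (isHomogeneous_X _ _)).sub
        ((isHomogeneous_X _ _).mul (isHomogeneous_X _ _))⟩
  have hmk : ∀ a c, Ideal.Quotient.mkₐ K J (monomial a c) = c • (a.toMultiset.map τ).prod := by
    intro a c
    rw [← aeval_monomial_eq_toMultiset]
    exact DFunLike.congr_fun (aeval_unique (Ideal.Quotient.mkₐ K J)) _
  have hfac : (fun a : (⊤ : SimpleGraph (Fin n)).edgeSet →₀ ℕ =>
      (a.toMultiset.map τ).prod).FactorsThrough bidegree := by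
    intro a b hab
    simp only [bidegree, Prod.mk.injEq] at hab
    exact hτ.prod_map_eq (by omega) hab.2
  have h := sum_coeff_smul_bidegree_eq_zero hf (Function.extend bidegree
    (fun a => (a.toMultiset.map τ).prod) 0)
  simp only [hfac.extend_apply, ← hmk, ← map_sum] at h
  rw [← f.as_sum, Ideal.Quotient.mkₐ_eq_mk, Ideal.Quotient.eq_zero_iff_mem] at h
  exact h

lemma eq_zero_of_mem_eulerianIdeal_of_lt_two {K : Type*} [Field K]
    {f : MvPolynomial (⊤ : SimpleGraph (Fin n)).edgeSet K} (hf : f ∈ eulerianIdeal K ⊤)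
    {d : ℕ} (hd : f.IsHomogeneous d) (hd2 : d < 2) : f = 0 := by
  classical
  ext a
  by_contra ha
  rw [coeff_zero] at ha
  have hcard : ∀ b, coeff b f ≠ 0 → b.toMultiset.card = d := by
    intro b hb
    rw [Finsupp.card_toMultiset, ← hd hb, Finsupp.weight_apply]
    simp [Finsupp.sum]
  have h := sum_coeff_smul_bidegree_eq_zero hf (fun g => if g = bidegree a then (1 : K) else 0)
  rw [Finset.sum_eq_single a] at h
  · simp [ha] at h
  · intro b hb hba
    rw [if_neg, smul_zero]
    intro hab
    rw [mem_support_iff] at hb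
    simp only [bidegree, Prod.mk.injEq] at hab
    apply hba
    apply Function.LeftInverse.injective Finsupp.toMultiset_toFinsupp
    exact eq_of_parity_eq_of_card_lt_two ((hcard b hb).trans_lt hd2) (by omega) hab.2
  · intro hs
    simp [notMem_support_iff.1 hs]

attribute [local instance] MvPolynomial.gradedAlgebra

lemma homogeneousComponent_mul_eq_zero {σ K : Type*} [Field K] {f : MvPolynomial σ K} {d k : ℕ}
    (hf : f.IsHomogeneous d) (hk : k < d) (g : MvPolynomial σ K) :
    homogeneousComponent k (g * f) = 0 :=
  (decomposition.decompose'_apply (g * f) k).symm.trans <|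
  DirectSum.coe_decompose_mul_of_right_mem_of_not_le (homogeneousSubmodule σ K) (a := g)
    ((mem_homogeneousSubmodule d f).2 hf) (not_le.2 hk)

/-- A generator of large degree is not needed to generate elements of small degree. -/
lemma mem_span_diff_singleton {σ K : Type*} [Field K] {S : Set (MvPolynomial σ K)}
    (hS : ∀ f ∈ S, ∃ d : ℕ, f.IsHomogeneous d) {f q : MvPolynomial σ K} {d k : ℕ}
    (hfd : f.IsHomogeneous d) (hkd : k < d) (hq : q.IsHomogeneous k)
    (hqS : q ∈ Ideal.span S) : q ∈ Ideal.span (S \ {f}) := by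
  have h1 : q ∈ Ideal.span (insert f (S \ {f})) :=
    Ideal.span_mono (by rw [Set.insert_sdiff_singleton]; exact Set.subset_insert _ _) hqS
  obtain ⟨g, r, hr, rfl⟩ := Ideal.mem_span_insert.1 h1
  have h2 := homogeneousComponent_eq_self hq
  rw [map_add, homogeneousComponent_mul_eq_zero hfd hkd, zero_add] at h2
  rw [← h2]
  exact homogeneousComponent_mem_of_mem
    (Ideal.homogeneous_span _ _ fun x hx => hS x hx.1) hr k

lemma exists_isHomogeneous_ne_zero (hn : 3 ≤ n) (K : Type*) [Field K] :
    ∃ q ∈ eulerianIdeal K (⊤ : SimpleGraph (Fin n)), q.IsHomogeneous 2 ∧ q ≠ 0 := by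
  let a : Fin n := ⟨0, by omega⟩
  let b : Fin n := ⟨1, by omega⟩
  let c : Fin n := ⟨2, by omega⟩
  have hab : a ≠ b := by simp [a, b]
  have hac : a ≠ c := by simp [a, c]
  have hbc : b ≠ c := by simp [b, c]
  refine ⟨X (topEdge hab) * X (topEdge hab) - X (topEdge hac) * X (topEdge hac),
    X_mul_X_sub_mem_eulerianIdeal K ?_, ((isHomogeneous_X _ _).mul (isHomogeneous_X _ _)).sub
        ((isHomogeneous_X _ _).mul (isHomogeneous_X _ _)), ?_⟩
  · funext v
    exact (CharTwo.add_self_eq_zero _).trans (CharTwo.add_self_eq_zero _).symm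
  · intro h
    have hne : topEdge hab ≠ topEdge hac := by
      intro h
      have : b ∈ (topEdge hac).1 := by rw [← h]; simp
      simp [hab.symm, hbc] at this
    have := congrArg (aeval (Pi.single (topEdge hab) (1 : K))) h
    simp [hne.symm] at this

lemma sSup_totalDegree_eq_two (hn : 3 ≤ n) (K : Type*) [Field K]
    {S : Set (MvPolynomial (⊤ : SimpleGraph (Fin n)).edgeSet K)}
    (hS : IsMinimalHomGenSet S (eulerianIdeal K (⊤ : SimpleGraph (Fin n)))) :
    sSup ((fun f : MvPolynomial (⊤ : SimpleGraph (Fin n)).edgeSet K =>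
      f.totalDegree) '' S) = 2 := by
  obtain ⟨hhom, hspan, hmin⟩ := hS
  have hne : ∀ f ∈ S, f ≠ 0 := by
    rintro f hf rfl
    exact hmin 0 hf (by rw [Ideal.span_sdiff_singleton_zero, hspan])
  have hle : ∀ f ∈ S, f.totalDegree ≤ 2 := by
    intro f hf
    by_contra! hlt
    obtain ⟨d, hd⟩ := hhom f hf
    rw [hd.totalDegree (hne f hf)] at hlt
    apply hmin f hf
    refine le_antisymm ((Ideal.span_mono Set.sdiff_subset).trans hspan.le) ?_
    rw [eulerianIdeal_eq_span, Ideal.span_le]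
    exact fun q hq => mem_span_diff_singleton hhom hd hlt hq.2 (hspan ▸ hq.1)
  apply IsGreatest.csSup_eq
  refine ⟨?_, by rintro _ ⟨f, hf, rfl⟩; exact hle f hf⟩
  obtain ⟨f, hf⟩ : S.Nonempty := by
    rw [Set.nonempty_iff_ne_empty]
    rintro rfl
    obtain ⟨q, hq, -, hq0⟩ := exists_isHomogeneous_ne_zero hn K
    rw [← hspan] at hq
    simp [hq0] at hq
  refine ⟨f, hf, le_antisymm (hle f hf) ?_⟩
  by_contra! hlt
  obtain ⟨d, hd⟩ := hhom f hf
  rw [hd.totalDegree (hne f hf)] at hlt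
  exact hne f hf (eq_zero_of_mem_eulerianIdeal_of_lt_two (hspan ▸ Ideal.subset_span hf) hd hlt)

end Algebra

/-- if `G` is the complete graph on `n ≥ 3` vertices, then `d(I(G)) = 2`:
every minimal homogeneous generating set of `I(G)` has maximal degree `2`, that is,
`I(G)` is generated by its elements of degree `2`. -/
theorem stmt9 {n : ℕ} (hn : 3 ≤ n) (K : Type*) [Field K] :
    (∀ S : Set (MvPolynomial (⊤ : SimpleGraph (Fin n)).edgeSet K),
      IsMinimalHomGenSet S (eulerianIdeal K (⊤ : SimpleGraph (Fin n))) →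
        sSup ((fun f : MvPolynomial (⊤ : SimpleGraph (Fin n)).edgeSet K =>
          f.totalDegree) '' S) = 2) ∧
    eulerianIdeal K (⊤ : SimpleGraph (Fin n)) =
      Ideal.span {f : MvPolynomial (⊤ : SimpleGraph (Fin n)).edgeSet K |
        f ∈ eulerianIdeal K (⊤ : SimpleGraph (Fin n)) ∧ f.IsHomogeneous 2} := by
  exact ⟨fun S hS => sSup_totalDegree_eq_two hn K hS, eulerianIdeal_eq_span K⟩
end

section
/- If G is bipartite, then the maximal generating degree of the Eulerian ideal satisfies d(I(G)) = 2 if and only if G is bipartite chordal, i.e. every cycle of G of length greater than 4 has a chord. -/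
open MvPolynomial Finset

variable {n : ℕ}

lemma zmodTwo_fun_add_self (f : Fin n → ZMod 2) : f + f = 0 :=
  funext fun i => CharTwo.add_self_eq_zero (f i)

lemma zmodTwo_fun_eq_of_add_eq_zero {f g : Fin n → ZMod 2} (h : f + g = 0) : f = g :=
  funext fun i => CharTwo.add_eq_zero.mp (congrFun h i)

/-- The characteristic vector modulo `2` of the set of endpoints of an edge. -/
def edgeBd (e : Sym2 (Fin n)) : Fin n → ZMod 2 := fun i => if i ∈ e then 1 else 0

lemma edgeBd_injective : Function.Injective (edgeBd : Sym2 (Fin n) → Fin n → ZMod 2) := by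
  intro e f h
  refine Sym2.ext fun i => ?_
  have := congrFun h i
  simp only [edgeBd] at this
  split_ifs at this <;> simp_all

lemma edgeBd_mk {a b : Fin n} (h : a ≠ b) :
    edgeBd s(a, b) = Pi.single a 1 + Pi.single b 1 := by
  funext i
  simp only [edgeBd, Sym2.mem_iff, Pi.add_apply, Pi.single_apply]
  split_ifs <;> simp_all

lemma sum_edgeBd {a b : Fin n} (h : a ≠ b) (T : Finset (Fin n)) :
    ∑ x ∈ T, edgeBd s(a, b) x = (if a ∈ T then 1 else 0) + (if b ∈ T then 1 else 0) := by
  simp [edgeBd_mk h, Finset.sum_add_distrib, Pi.single_apply]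

lemma exists_parity_set {G : SimpleGraph (Fin n)} (hbip : G.Colorable 2) :
    ∃ T : Finset (Fin n), ∀ e ∈ G.edgeSet, ∑ x ∈ T, edgeBd e x = 1 := by
  obtain ⟨c⟩ := hbip
  refine ⟨Finset.univ.filter fun x => c x = 0, fun e he => ?_⟩
  induction e using Sym2.ind with
  | _ a b =>
    have hab : G.Adj a b := he
    have hc := c.valid hab
    rw [sum_edgeBd hab.ne]
    simp only [Finset.mem_filter, Finset.mem_univ, true_and]
    generalize c a = p at hc ⊢
    generalize c b = q at hc ⊢
    revert p q
    decide

lemma even_card_of_sum_edgeBd_eq_zero {G : SimpleGraph (Fin n)} (hbip : G.Colorable 2)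
    {C : Finset G.edgeSet} (hC : ∑ e ∈ C, edgeBd e.1 = 0) : Even C.card := by
  obtain ⟨T, hT⟩ := exists_parity_set hbip
  rw [← ZMod.natCast_eq_zero_iff_even]
  have h1 : ∑ e ∈ C, ∑ x ∈ T, edgeBd e.1 x = (C.card : ZMod 2) := by
    simp [fun e : G.edgeSet => hT e.1 e.2]
  rw [← h1, Finset.sum_comm]
  refine Finset.sum_eq_zero fun x _ => ?_
  simpa using congrFun hC x

lemma four_le_card_of_sum_edgeBd_eq_zero {G : SimpleGraph (Fin n)} (hbip : G.Colorable 2)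
    {C : Finset G.edgeSet} (hC : ∑ e ∈ C, edgeBd e.1 = 0) (hne : C.Nonempty) :
    4 ≤ C.card := by
  obtain ⟨k, hk⟩ := even_card_of_sum_edgeBd_eq_zero hbip hC
  have h2 : C.card ≠ 2 := by
    intro h
    obtain ⟨e, f, hef, rfl⟩ := Finset.card_eq_two.mp h
    rw [Finset.sum_pair hef] at hC
    exact hef (Subtype.ext (edgeBd_injective (zmodTwo_fun_eq_of_add_eq_zero hC)))
  have := hne.card_pos
  omega

lemma exists_isCycle_of_sum_edgeBd_eq_zero {G : SimpleGraph (Fin n)}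
    {C : Finset G.edgeSet} (hC : ∑ e ∈ C, edgeBd e.1 = 0) (hne : C.Nonempty) :
    ∃ (v : Fin n) (w : G.Walk v v), w.IsCycle ∧ ∀ e ∈ w.edges, ∃ h, (⟨e, h⟩ : G.edgeSet) ∈ C := by
  classical
  set H : SimpleGraph (Fin n) := SimpleGraph.fromEdgeSet (Subtype.val '' (C : Set G.edgeSet))
    with hH
  have hadj : ∀ a b, H.Adj a b ↔ ∃ h : G.Adj a b, (⟨s(a, b), h⟩ : G.edgeSet) ∈ C := by
    intro a b
    rw [hH, SimpleGraph.fromEdgeSet_adj]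
    constructor
    · rintro ⟨⟨e, he, h⟩, hab⟩
      have : G.Adj a b := by
        have := e.2
        rwa [h] at this
      refine ⟨this, ?_⟩
      convert! he
      exact Subtype.ext h.symm
    · rintro ⟨h, h'⟩
      exact ⟨⟨_, h', rfl⟩, h.ne⟩
  have hle : H ≤ G := fun a b h => ((hadj a b).1 h).1
  by_cases hac : H.IsAcyclic
  · exfalso
    obtain ⟨⟨e, he⟩, heC⟩ := hne
    induction e using Sym2.ind with
    | _ u v =>
      have huv : G.Adj u v := he
      have hb := SimpleGraph.isAcyclic_iff_forall_adj_isBridge.1 hac ((hadj u v).2 ⟨he, heC⟩)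
      rw [SimpleGraph.isBridge_iff] at hb
      set H' := H.deleteEdges {s(u, v)}
      set T : Finset (Fin n) := Finset.univ.filter fun x => H'.Reachable u x with hT
      have hmem : ∀ x, x ∈ T ↔ H'.Reachable u x := by simp [hT]
      have h0 : ∑ f ∈ C, ∑ x ∈ T, edgeBd f.1 x = 0 := by
        rw [Finset.sum_comm]
        refine Finset.sum_eq_zero fun x _ => ?_
        simpa using congrFun hC x
      rw [Finset.sum_eq_single_of_mem _ heC] at h0
      · rw [sum_edgeBd huv.ne, if_pos ((hmem u).2 (SimpleGraph.Reachable.refl u)),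
          if_neg (fun h => hb ((hmem v).1 h))] at h0
        simp at h0
      · rintro ⟨f, hf⟩ hfC hne
        induction f using Sym2.ind with
        | _ a b =>
          have hab : G.Adj a b := hf
          have hab' : H'.Adj a b := by
            rw [SimpleGraph.deleteEdges_adj]
            refine ⟨(hadj a b).2 ⟨hf, hfC⟩, fun h => hne (Subtype.ext h)⟩
          rw [sum_edgeBd hab.ne]
          have : a ∈ T ↔ b ∈ T := by
            rw [hmem, hmem]
            exact ⟨fun h => h.trans hab'.reachable, fun h => h.trans hab'.symm.reachable⟩
          by_cases haT : a ∈ T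
          · rw [if_pos haT, if_pos (this.1 haT)]; decide
          · rw [if_neg haT, if_neg (fun h => haT (this.2 h))]; simp
  · simp only [SimpleGraph.IsAcyclic, not_forall, not_not] at hac
    obtain ⟨v, w, hw⟩ := hac
    refine ⟨v, w.mapLe hle, hw.mapLe hle, fun e he => ?_⟩
    have he' : e ∈ H.edgeSet := w.edges_subset_edgeSet (by simpa using he)
    induction e using Sym2.ind with
    | _ a b => exact (hadj a b).1 he'

lemma sum_edgeBd_walk {G : SimpleGraph (Fin n)} {u v : Fin n} (w : G.Walk u v) :
    (w.edges.map edgeBd).sum = Pi.single u 1 + Pi.single v 1 := by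
  induction w with
  | nil => simp [zmodTwo_fun_add_self]
  | cons h p ih =>
    rw [SimpleGraph.Walk.edges_cons, List.map_cons, List.sum_cons, ih, edgeBd_mk h.ne, add_assoc,
      ← add_assoc (Pi.single _ 1 : Fin n → ZMod 2) _ (Pi.single _ 1),
      zmodTwo_fun_add_self, zero_add]

/-- The edges of `G` occurring in a list of pairs of vertices. -/
def edgesIn (G : SimpleGraph (Fin n)) [DecidableRel G.Adj] (l : List (Sym2 (Fin n))) :
    Finset G.edgeSet :=
  l.toFinset.subtype (· ∈ G.edgeSet)

lemma mem_edgesIn {G : SimpleGraph (Fin n)} [DecidableRel G.Adj] {l : List (Sym2 (Fin n))}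
    {e : G.edgeSet} : e ∈ edgesIn G l ↔ e.1 ∈ l := by
  simp [edgesIn]

lemma sum_edgesIn {G : SimpleGraph (Fin n)} [DecidableRel G.Adj] {M : Type*} [AddCommMonoid M]
    {l : List (Sym2 (Fin n))} (hl : l.Nodup) (h : ∀ e ∈ l, e ∈ G.edgeSet)
    (f : Sym2 (Fin n) → M) : ∑ e ∈ edgesIn G l, f e.1 = (l.map f).sum := by
  rw [edgesIn, Finset.sum_subtype_of_mem f (by simpa using h), List.sum_toFinset f hl]

lemma card_edgesIn {G : SimpleGraph (Fin n)} [DecidableRel G.Adj]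
    {l : List (Sym2 (Fin n))} (hl : l.Nodup) (h : ∀ e ∈ l, e ∈ G.edgeSet) :
    (edgesIn G l).card = l.length := by
  have := sum_edgesIn (M := ℕ) hl h (fun _ => 1)
  simpa using this

/-- In a bipartite chordal graph, a large Eulerian set can be traded for a smaller Eulerian set
using at most one new edge. -/
lemma exists_smaller_eulerian {G : SimpleGraph (Fin n)} (hbip : G.Colorable 2)
    (hch : ∀ C : Finset G.edgeSet, IsCycleSet G C → 4 < C.card → ∃ l : G.edgeSet, IsChord G C l)
    {C : Finset G.edgeSet} (hC : ∑ e ∈ C, edgeBd e.1 = 0) (hcard : 4 < C.card) :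
    ∃ D : Finset G.edgeSet, ∑ e ∈ D, edgeBd e.1 = 0 ∧ 4 ≤ D.card ∧ D.card < C.card ∧
      (D \ C).card ≤ 1 := by
  classical
  obtain ⟨v, w, hw, hsub⟩ := exists_isCycle_of_sum_edgeBd_eq_zero hC
    (Finset.card_pos.mp (by omega))
  have hwG : ∀ e ∈ w.edges, e ∈ G.edgeSet := fun e he => w.edges_subset_edgeSet he
  have hnd := hw.edges_nodup
  have hle : edgesIn G w.edges ⊆ C := by
    intro e he
    exact (hsub e.1 (mem_edgesIn.1 he)).2
  have hEul : ∑ e ∈ edgesIn G w.edges, edgeBd e.1 = 0 := by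
    rw [sum_edgesIn hnd hwG, sum_edgeBd_walk, zmodTwo_fun_add_self]
  have hlen : (edgesIn G w.edges).card = w.length := by
    rw [card_edgesIn hnd hwG, SimpleGraph.Walk.length_edges]
  rcases (Finset.card_le_card hle).lt_or_eq with hlt | heq
  · refine ⟨_, hEul, four_le_card_of_sum_edgeBd_eq_zero hbip hEul ?_, hlt, ?_⟩
    · rw [← Finset.card_pos, hlen]
      have := hw.three_le_length
      omega
    · rw [Finset.sdiff_eq_empty_iff_subset.2 hle]; simp
  have hCw : edgesIn G w.edges = C := Finset.eq_of_subset_of_card_le hle heq.ge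
  have hmem : ∀ e : G.edgeSet, e ∈ C ↔ e.1 ∈ w.edges := fun e => by rw [← hCw, mem_edgesIn]
  obtain ⟨⟨l, hl⟩, hlC, hlv⟩ := hch C ⟨v, w, hw, by
    ext e
    simp only [Finset.mem_image, List.mem_toFinset, hmem]
    exact ⟨by rintro ⟨f, hf, rfl⟩; exact hf, fun he => ⟨⟨e, hwG e he⟩, he, rfl⟩⟩⟩ hcard
  have hsupp : ∀ i ∈ edgeVerts G C, i ∈ w.support := by
    intro i hi
    simp only [edgeVerts, Finset.mem_filter, Finset.mem_univ, true_and] at hi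
    obtain ⟨e, he, hie⟩ := hi
    exact SimpleGraph.Walk.mem_support_of_mem_edges ((hmem e).1 he) hie
  induction l using Sym2.ind with
  | _ a b =>
    have hab : G.Adj a b := hl
    have ha := hsupp a (hlv a (by simp))
    have hb := hsupp b (hlv b (by simp))
    have hlw : s(a, b) ∉ w.edges := fun h => hlC ((hmem _).2 h)
    set w' := w.rotate a ha with hw'
    have hw'c : w'.IsCycle := hw.rotate ha
    have hperm : ∀ e, e ∈ w'.edges ↔ e ∈ w.edges := fun e => (w.rotate_edges a ha).mem_iff
    have hb' : b ∈ w'.support := by simpa [hw'] using hb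
    set p := w'.takeUntil b hb' with hp
    set q := w'.dropUntil b hb' with hq
    have hedges : w'.edges = p.edges ++ q.edges := by
      rw [← SimpleGraph.Walk.edges_append, SimpleGraph.Walk.take_spec]
    have hnd' := hw'c.edges_nodup
    rw [hedges] at hnd'
    have hpw : ∀ e ∈ p.edges, e ∈ w.edges := fun e he => (hperm e).1 (by simp [hedges, he])
    have hqw : ∀ e ∈ q.edges, e ∈ w.edges := fun e he => (hperm e).1 (by simp [hedges, he])
    have hnd2 : (s(a, b) :: p.edges).Nodup :=
      List.nodup_cons.2 ⟨fun h => hlw (hpw _ h), hnd'.of_append_left⟩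
    have hG2 : ∀ e ∈ s(a, b) :: p.edges, e ∈ G.edgeSet := by
      intro e he
      rcases List.mem_cons.1 he with rfl | he
      · exact hl
      · exact hwG _ (hpw _ he)
    have hCcard : C.card = p.length + q.length := by
      have h1 : w'.length = w.length := by simp [hw']
      have h2 := congrArg List.length hedges
      simp only [SimpleGraph.Walk.length_edges, List.length_append] at h2
      rw [← hCw, hlen, ← h1, h2]
    have hq2 : 2 ≤ q.length := by
      by_contra hlt
      cases hqq : q with
      | nil => exact hab.ne rfl
      | cons h r =>
        rw [hqq, SimpleGraph.Walk.length_cons] at hlt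
        have hr : r.length = 0 := by omega
        obtain rfl := SimpleGraph.Walk.eq_of_length_eq_zero hr
        exact hlw (hqw _ (by rw [hqq]; simp [Sym2.eq_swap]))
    have hE2 : ∑ e ∈ edgesIn G (s(a, b) :: p.edges), edgeBd e.1 = 0 := by
      rw [sum_edgesIn hnd2 hG2, List.map_cons, List.sum_cons, sum_edgeBd_walk, edgeBd_mk hab.ne,
        zmodTwo_fun_add_self]
    refine ⟨_, hE2, four_le_card_of_sum_edgeBd_eq_zero hbip hE2
      ⟨⟨s(a, b), hl⟩, mem_edgesIn.2 (by simp)⟩, ?_, ?_⟩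
    · rw [card_edgesIn hnd2 hG2, List.length_cons, SimpleGraph.Walk.length_edges]
      omega
    · refine (Finset.card_le_card (t := {⟨s(a, b), hl⟩}) ?_).trans (by simp)
      intro e he
      rw [Finset.mem_sdiff, mem_edgesIn, List.mem_cons, hmem] at he
      rw [Finset.mem_singleton]
      exact Subtype.ext (he.1.resolve_right fun h => he.2 (hpw _ h))

/-- The sum modulo `2` of the characteristic vectors of the edges of a multiset of edges. -/
noncomputable def bd (G : SimpleGraph (Fin n)) : (G.edgeSet →₀ ℕ) →ₗ[ℕ] (Fin n → ZMod 2) :=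
  Finsupp.linearCombination ℕ fun e => edgeBd e.1

@[simp]
lemma bd_single (G : SimpleGraph (Fin n)) (e : G.edgeSet) (k : ℕ) :
    bd G (Finsupp.single e k) = k • edgeBd e.1 := by
  simp [bd]

/-- Two multisets of edges have the same size and the same boundary modulo `2`. -/
def SameClass (G : SimpleGraph (Fin n)) (α β : G.edgeSet →₀ ℕ) : Prop :=
  α.degree = β.degree ∧ bd G α = bd G β

lemma SameClass.symm {G : SimpleGraph (Fin n)} {α β : G.edgeSet →₀ ℕ} (h : SameClass G α β) :
    SameClass G β α := ⟨h.1.symm, h.2.symm⟩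

lemma SameClass.trans {G : SimpleGraph (Fin n)} {α β γ : G.edgeSet →₀ ℕ} (h : SameClass G α β)
    (h' : SameClass G β γ) : SameClass G α γ := ⟨h.1.trans h'.1, h.2.trans h'.2⟩

lemma sameClass_add_right_iff {G : SimpleGraph (Fin n)} {α β γ : G.edgeSet →₀ ℕ} :
    SameClass G (α + γ) (β + γ) ↔ SameClass G α β := by
  simp [SameClass]

lemma sameClass_single_two {G : SimpleGraph (Fin n)} (e f : G.edgeSet) :
    SameClass G (Finsupp.single e 2) (Finsupp.single f 2) := by
  refine ⟨by simp, ?_⟩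
  rw [bd_single, bd_single, two_nsmul, two_nsmul, zmodTwo_fun_add_self, zmodTwo_fun_add_self]

lemma degree_indicator {ι : Type*} (D : Finset ι) :
    (∑ e ∈ D, Finsupp.single e 1 : ι →₀ ℕ).degree = D.card := by
  simp

lemma bd_indicator {G : SimpleGraph (Fin n)} (D : Finset G.edgeSet) :
    bd G (∑ e ∈ D, Finsupp.single e 1) = ∑ e ∈ D, edgeBd e.1 := by
  simp

lemma indicator_apply {ι : Type*} [DecidableEq ι] (D : Finset ι) (e : ι) :
    (∑ e ∈ D, Finsupp.single e 1 : ι →₀ ℕ) e = if e ∈ D then 1 else 0 := by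
  simp [Finsupp.finsetSum_apply, Finsupp.single_apply]

lemma eq_indicator_support {ι : Type*} {α : ι →₀ ℕ} (h : ∀ e, α e ≤ 1) :
    α = ∑ e ∈ α.support, Finsupp.single e 1 := by
  classical
  ext e
  rw [indicator_apply]
  have := h e
  split_ifs with he
  · have := Finsupp.mem_support_iff.1 he
    omega
  · simpa using he

section Moves

variable {G : SimpleGraph (Fin n)} {R : (G.edgeSet →₀ ℕ) → (G.edgeSet →₀ ℕ) → Prop} {d : ℕ}

lemma rel_of_common_edge (hadd : ∀ α β γ, R α β → R (α + γ) (β + γ))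
    (ih : ∀ α β, SameClass G α β → α.degree < d → R α β) {α β : G.edgeSet →₀ ℕ}
    (h : SameClass G α β) (hd : α.degree = d) {e : G.edgeSet} (ha : α e ≠ 0) (hb : β e ≠ 0) :
    R α β := by
  have hle : ∀ γ : G.edgeSet →₀ ℕ, γ e ≠ 0 → γ - Finsupp.single e 1 + Finsupp.single e 1 = γ :=
    fun γ hγ => tsub_add_cancel_of_le (by simpa [Nat.one_le_iff_ne_zero] using hγ)
  rw [← hle α ha, ← hle β hb] at h ⊢
  refine hadd _ _ _ (ih _ _ (sameClass_add_right_iff.1 h) ?_)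
  rw [← hd]
  conv_rhs => rw [← hle α ha]
  simp

lemma rel_of_double_edge (hR : Equivalence R) (hadd : ∀ α β γ, R α β → R (α + γ) (β + γ))
    (h2 : ∀ α β, SameClass G α β → α.degree = 2 → R α β)
    (ih : ∀ α β, SameClass G α β → α.degree < d → R α β) {α β : G.edgeSet →₀ ℕ}
    (h : SameClass G α β) (hd : α.degree = d) {e : G.edgeSet} (ha : 2 ≤ α e) :
    R α β := by
  have hα : Finsupp.single e 2 + (α - Finsupp.single e 2) = α :=
    add_tsub_cancel_of_le (by simpa using ha)
  obtain ⟨f, hf⟩ : ∃ f, β f ≠ 0 := by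
    by_contra! hβ
    have hβ0 : β = 0 := Finsupp.ext hβ
    have h1 := h.1
    rw [hβ0, ← hα] at h1
    simp at h1
  have hcl : SameClass G α (Finsupp.single f 2 + (α - Finsupp.single e 2)) := by
    conv_lhs => rw [← hα]
    exact sameClass_add_right_iff.2 (sameClass_single_two e f)
  refine hR.trans (y := Finsupp.single f 2 + (α - Finsupp.single e 2)) ?_ ?_
  · conv_lhs => rw [← hα]
    exact hadd _ _ _ (h2 _ _ (sameClass_single_two e f) (by simp))
  · exact rel_of_common_edge hadd ih (hcl.symm.trans h) (hcl.1.symm.trans hd) (e := f) (by simp) hf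

lemma rel_of_exchange (hR : Equivalence R) (hadd : ∀ α β γ, R α β → R (α + γ) (β + γ))
    (h2 : ∀ α β, SameClass G α β → α.degree = 2 → R α β)
    (ih : ∀ α β, SameClass G α β → α.degree < d → R α β) {A B D : Finset G.edgeSet}
    (h : SameClass G (∑ e ∈ A, Finsupp.single e 1) (∑ e ∈ B, Finsupp.single e 1))
    (hd : A.card = d) (hD : ∑ e ∈ D, edgeBd e.1 = 0) {a : ℕ} (ha : D.card = a + a) (ha2 : 2 ≤ a)
    (had : a < d) (hDAB : (D \ (A ∪ B)).card ≤ 1) (hAD : a ≤ (A ∩ D).card) :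
    R (∑ e ∈ A, Finsupp.single e 1) (∑ e ∈ B, Finsupp.single e 1) := by
  obtain ⟨A', hA', hcard⟩ := Finset.exists_subset_card_eq hAD
  have hA'A : A' ⊆ A := hA'.trans Finset.inter_subset_left
  have hA'D : A' ⊆ D := hA'.trans Finset.inter_subset_right
  have hDA' : (D \ A').card = a := by
    rw [Finset.card_sdiff_of_subset hA'D]
    omega
  have hcl : SameClass G (∑ e ∈ A', Finsupp.single e 1) (∑ e ∈ D \ A', Finsupp.single e 1) := by
    refine ⟨by rw [degree_indicator, degree_indicator, hcard, hDA'], ?_⟩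
    rw [bd_indicator, bd_indicator]
    rw [← Finset.sum_sdiff hA'D] at hD
    exact (zmodTwo_fun_eq_of_add_eq_zero hD).symm
  have hRA := ih _ _ hcl (by rw [degree_indicator, hcard]; exact had)
  have hsplit : (∑ e ∈ A, Finsupp.single e 1 : G.edgeSet →₀ ℕ) =
      ∑ e ∈ A', Finsupp.single e 1 + ∑ e ∈ A \ A', Finsupp.single e 1 := by
    rw [add_comm, Finset.sum_sdiff hA'A]
  have hcl' : SameClass G (∑ e ∈ A, Finsupp.single e 1)
      (∑ e ∈ D \ A', Finsupp.single e 1 + ∑ e ∈ A \ A', Finsupp.single e 1) := by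
    rw [hsplit]
    exact sameClass_add_right_iff.2 hcl
  obtain ⟨e, he, heAB⟩ : ∃ e ∈ D \ A', e ∈ A ∪ B := by
    by_contra! hno
    have : D \ A' ⊆ D \ (A ∪ B) := fun e he =>
      Finset.mem_sdiff.2 ⟨(Finset.mem_sdiff.1 he).1, hno e he⟩
    have := Finset.card_le_card this
    omega
  have hdeg := hcl'.1.symm.trans ((degree_indicator A).trans hd)
  refine hR.trans (y := ∑ e ∈ D \ A', Finsupp.single e 1 + ∑ e ∈ A \ A', Finsupp.single e 1) ?_ ?_
  · rw [hsplit]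
    exact hadd _ _ _ hRA
  · by_cases heA : e ∈ A
    · refine rel_of_double_edge hR hadd h2 ih (hcl'.symm.trans h) hdeg (e := e) ?_
      rw [Finsupp.add_apply, indicator_apply, indicator_apply, if_pos he,
        if_pos (Finset.mem_sdiff.2 ⟨heA, (Finset.mem_sdiff.1 he).2⟩)]
    · have heB : e ∈ B := (Finset.mem_union.1 heAB).resolve_left heA
      refine rel_of_common_edge hadd ih (hcl'.symm.trans h) hdeg (e := e) ?_ ?_
      · rw [Finsupp.add_apply, indicator_apply, if_pos he]
        omega
      · rw [indicator_apply, if_pos heB]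
        exact one_ne_zero

lemma rel_of_sameClass (hbip : G.Colorable 2)
    (hch : ∀ C : Finset G.edgeSet, IsCycleSet G C → 4 < C.card → ∃ l : G.edgeSet, IsChord G C l)
    (hR : Equivalence R) (hadd : ∀ α β γ, R α β → R (α + γ) (β + γ))
    (h2 : ∀ α β, SameClass G α β → α.degree = 2 → R α β) {α β : G.edgeSet →₀ ℕ}
    (h : SameClass G α β) : R α β := by
  induction hd : α.degree using Nat.strong_induction_on generalizing α β with
  | _ d ih' =>
  have ih : ∀ α β, SameClass G α β → α.degree < d → R α β :=
    fun α β h hlt => ih' _ hlt h rfl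
  by_cases hcommon : ∃ e, α e ≠ 0 ∧ β e ≠ 0
  · obtain ⟨e, ha, hb⟩ := hcommon
    exact rel_of_common_edge hadd ih h hd ha hb
  by_cases hsqa : ∃ e, 2 ≤ α e
  · obtain ⟨e, he⟩ := hsqa
    exact rel_of_double_edge hR hadd h2 ih h hd he
  by_cases hsqb : ∃ e, 2 ≤ β e
  · obtain ⟨e, he⟩ := hsqb
    exact hR.symm (rel_of_double_edge hR hadd h2 ih h.symm (h.1.symm.trans hd) he)
  push Not at hcommon hsqa hsqb
  by_cases hd2 : d = 2
  · exact h2 _ _ h (hd.trans hd2)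
  have hα := eq_indicator_support fun e => Nat.lt_succ_iff.1 (hsqa e)
  have hβ := eq_indicator_support fun e => Nat.lt_succ_iff.1 (hsqb e)
  have hdisj : Disjoint α.support β.support := by
    rw [Finset.disjoint_left]
    intro e he he'
    exact (Finsupp.mem_support_iff.1 he') (hcommon e (Finsupp.mem_support_iff.1 he))
  generalize α.support = A at hα hdisj
  generalize β.support = B at hβ hdisj
  subst hα hβ
  have hA : A.card = d := by rw [← hd, degree_indicator]
  have hB : B.card = d := by rw [← hd, h.1, degree_indicator]
  have hAB : (A ∪ B).card = d + d := by rw [Finset.card_union_of_disjoint hdisj, hA, hB]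
  have hEul : ∑ e ∈ A ∪ B, edgeBd e.1 = 0 := by
    have := h.2
    rw [bd_indicator, bd_indicator] at this
    rw [Finset.sum_union hdisj, this, zmodTwo_fun_add_self]
  by_cases hd0 : d = 0
  · obtain rfl := Finset.card_eq_zero.1 (hA.trans hd0)
    obtain rfl := Finset.card_eq_zero.1 (hB.trans hd0)
    exact hR.refl _
  have h4 := four_le_card_of_sum_edgeBd_eq_zero hbip hEul (Finset.card_pos.1 (by omega))
  obtain ⟨D, hD, hD4, hDlt, hD1⟩ := exists_smaller_eulerian hbip hch hEul (by omega)
  obtain ⟨a, ha⟩ := even_card_of_sum_edgeBd_eq_zero hbip hD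
  have hcount : D.card ≤ (A ∩ D).card + (B ∩ D).card + 1 := by
    rw [← Finset.card_sdiff_add_card_inter D (A ∪ B), Finset.inter_comm D,
      Finset.union_inter_distrib_right]
    have := Finset.card_union_le (A ∩ D) (B ∩ D)
    omega
  by_cases hAD : a ≤ (A ∩ D).card
  · exact rel_of_exchange hR hadd h2 ih h hA hD ha (by omega) (by omega) hD1 hAD
  · exact hR.symm (rel_of_exchange hR hadd h2 ih h.symm hB hD ha (by omega) (by omega)
      (by rwa [Finset.union_comm]) (by omega))

end Moves

section Algebra

variable {K : Type*} [Field K] {G : SimpleGraph (Fin n)}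

lemma phiG_monomial (K : Type*) [Field K] (G : SimpleGraph (Fin n)) (α : G.edgeSet →₀ ℕ) :
    ∃ a : Fin n →₀ ℕ, phiG K G (monomial α 1) = monomial a 1 ∧ a.degree = 2 * α.degree ∧
      ∀ i, (a i : ZMod 2) = bd G α i := by
  induction α using Finsupp.induction_linear with
  | zero => exact ⟨0, by simp⟩
  | add α β hα hβ =>
    obtain ⟨a, ha, ha1, ha2⟩ := hα
    obtain ⟨b, hb, hb1, hb2⟩ := hβ
    refine ⟨a + b, ?_, ?_, ?_⟩
    · rw [← mul_one (1 : K), ← monomial_mul, map_mul, ha, hb, monomial_mul]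
    · rw [map_add, map_add, ha1, hb1, mul_add]
    · intro i
      rw [Finsupp.add_apply, Nat.cast_add, ha2, hb2, map_add, Pi.add_apply]
  | single e k =>
    obtain ⟨e, he⟩ := e
    induction e using Sym2.ind with
    | _ i j =>
      have hij : G.Adj i j := he
      refine ⟨k • (Finsupp.single i 1 + Finsupp.single j 1), ?_, ?_, ?_⟩
      · rw [← X_pow_eq_monomial, map_pow]
        simp only [phiG, aeval_X, edgeMono, Sym2.lift_mk]
        rw [X, X, monomial_mul, monomial_pow, one_mul, one_pow]
      · simp only [map_nsmul, map_add, Finsupp.degree_single, smul_eq_mul]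
        ring
      · intro x
        simp only [bd_single, edgeBd_mk hij.ne, Finsupp.smul_apply, Finsupp.add_apply,
          Finsupp.single_apply, Pi.smul_apply, Pi.add_apply, Pi.single_apply, smul_eq_mul,
          nsmul_eq_mul, Nat.cast_mul, Nat.cast_add, eq_comm (a := x)]
        split_ifs <;> simp

/-- The parity and degree grading of `K[x_1,…,x_n]`, as a map to a monoid algebra. -/
noncomputable def parityMap (K : Type*) [Field K] (n : ℕ) :
    MvPolynomial (Fin n) K →ₐ[K] AddMonoidAlgebra K ((Fin n → ZMod 2) × ℕ) :=
  aeval fun i => AddMonoidAlgebra.single (Pi.single i 1, 1) 1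

lemma parityMap_monomial (a : Fin n →₀ ℕ) :
    parityMap K n (monomial a 1) = AddMonoidAlgebra.single (fun i => (a i : ZMod 2), a.degree) 1 := by
  induction a using Finsupp.induction_linear with
  | zero =>
    rw [monomial_zero', C_1, map_one, AddMonoidAlgebra.one_def]
    congr 1
  | add a b ha hb =>
    rw [← mul_one (1 : K), ← monomial_mul, map_mul, ha, hb, AddMonoidAlgebra.single_mul_single]
    congr 1
    ext <;> simp
  | single i k =>
    rw [← X_pow_eq_monomial, map_pow, parityMap, aeval_X, AddMonoidAlgebra.single_pow, one_pow]
    congr 1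
    ext x
    · by_cases h : x = i <;> simp [h]
    · simp

lemma parityMap_eq_zero {p : MvPolynomial (Fin n) K}
    (hp : p ∈ Ideal.span {f : MvPolynomial (Fin n) K | ∃ i j : Fin n, f = X i ^ 2 - X j ^ 2}) :
    parityMap K n p = 0 := by
  rw [← RingHom.mem_ker]
  revert p
  change _ ≤ RingHom.ker _
  rw [Ideal.span_le]
  rintro _ ⟨i, j, rfl⟩
  have key : ∀ i : Fin n, parityMap K n (X i ^ 2) = AddMonoidAlgebra.single (0, 2) 1 := by
    intro i
    rw [map_pow, parityMap, aeval_X, AddMonoidAlgebra.single_pow, one_pow, Prod.smul_mk, two_nsmul,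
      zmodTwo_fun_add_self]
    rfl
  rw [SetLike.mem_coe, RingHom.mem_ker, map_sub, key, key, sub_self]

lemma parityMap_phiG_monomial (α : G.edgeSet →₀ ℕ) (c : K) :
    parityMap K n (phiG K G (monomial α c)) = AddMonoidAlgebra.single (bd G α, 2 * α.degree) c := by
  obtain ⟨a, ha, ha1, ha2⟩ := phiG_monomial K G α
  rw [← mul_one c, ← smul_eq_mul, ← smul_monomial, map_smul, map_smul, ha, parityMap_monomial,
    AddMonoidAlgebra.smul_single, ha1, funext ha2]

open Classical in
lemma sum_coeff_class_eq_zero {f : MvPolynomial G.edgeSet K} (hf : f ∈ eulerianIdeal K G)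
    (α : G.edgeSet →₀ ℕ) : ∑ β ∈ f.support with SameClass G β α, coeff β f = 0 := by
  have h0 : parityMap K n (phiG K G f) = 0 := parityMap_eq_zero hf
  rw [← support_sum_monomial_coeff f, map_sum, map_sum] at h0
  have h1 := congrArg (fun p => p.coeff (bd G α, 2 * α.degree)) h0
  simp only [parityMap_phiG_monomial, AddMonoidAlgebra.coeff_sum, Finsupp.finsetSum_apply,
    AddMonoidAlgebra.coeff_single, Finsupp.single_apply] at h1
  rw [Finset.sum_filter]
  convert! h1 using 3 with β
  simp only [SameClass, Prod.mk.injEq]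
  constructor
  · rintro ⟨h, h'⟩
    exact ⟨h', by rw [h]⟩
  · rintro ⟨h, h'⟩
    exact ⟨by omega, h⟩

lemma coeff_eq_zero_of_unique {f : MvPolynomial G.edgeSet K} (hf : f ∈ eulerianIdeal K G)
    {α : G.edgeSet →₀ ℕ} (hα : ∀ β, SameClass G β α → β = α) : coeff α f = 0 := by
  classical
  by_contra hne
  have h := sum_coeff_class_eq_zero hf α
  rw [Finset.sum_eq_single_of_mem α] at h
  · exact hne h
  · exact Finset.mem_filter.2 ⟨mem_support_iff.2 hne, rfl, rfl⟩
  · intro β hβ hne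
    exact absurd (hα β (Finset.mem_filter.1 hβ).2) hne

lemma mk_monomial_eq (I : Ideal (MvPolynomial (Fin n) K))
    (hI : ∀ i j : Fin n, (X i ^ 2 - X j ^ 2 : MvPolynomial (Fin n) K) ∈ I) (i₀ : Fin n)
    (a : Fin n →₀ ℕ) :
    Ideal.Quotient.mk I (monomial a 1) =
      (∏ i, Ideal.Quotient.mk I (X i) ^ (a i % 2)) *
        (Ideal.Quotient.mk I (X i₀) ^ 2) ^ (∑ i, a i / 2) := by
  rw [monomial_eq, Finsupp.prod_fintype _ _ (by simp), C_1, one_mul, map_prod,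
    ← Finset.prod_pow_eq_pow_sum, ← Finset.prod_mul_distrib]
  refine Finset.prod_congr rfl fun i _ => ?_
  have h : Ideal.Quotient.mk I (X i₀) ^ 2 = Ideal.Quotient.mk I (X i) ^ 2 := by
    rw [← map_pow, ← map_pow]
    exact Ideal.Quotient.eq.2 (hI i₀ i)
  rw [h, ← pow_mul, ← pow_add, map_pow, Nat.mod_add_div]

lemma monomial_sub_monomial_mem {α β : G.edgeSet →₀ ℕ} (h : SameClass G α β) :
    (monomial α 1 - monomial β 1 : MvPolynomial G.edgeSet K) ∈ eulerianIdeal K G := by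
  rcases Nat.eq_zero_or_pos n with rfl | hn
  · have : α = β := by
      ext e
      exact Sym2.ind (fun i _ => i.elim0) e.1
    rw [this, sub_self]
    exact zero_mem _
  obtain ⟨a, ha, ha1, ha2⟩ := phiG_monomial K G α
  obtain ⟨b, hb, hb1, hb2⟩ := phiG_monomial K G β
  rw [eulerianIdeal, Ideal.mem_comap, map_sub, ha, hb, ← Ideal.Quotient.eq]
  have hI : ∀ i j : Fin n, (X i ^ 2 - X j ^ 2 : MvPolynomial (Fin n) K) ∈
      Ideal.span {f | ∃ i j : Fin n, f = X i ^ 2 - X j ^ 2} :=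
    fun i j => Ideal.subset_span ⟨i, j, rfl⟩
  rw [mk_monomial_eq _ hI ⟨0, hn⟩, mk_monomial_eq _ hI ⟨0, hn⟩]
  have hmod : ∀ i, a i % 2 = b i % 2 := fun i => by
    have : (a i : ZMod 2) = b i := by rw [ha2, hb2, h.2]
    exact (ZMod.natCast_eq_natCast_iff' _ _ _).1 this
  have hdeg : ∑ i, a i = ∑ i, b i := by
    rw [← Finsupp.degree_eq_sum, ← Finsupp.degree_eq_sum, ha1, hb1, h.1]
  have hdiv : ∑ i, a i / 2 = ∑ i, b i / 2 := by
    have e1 : ∀ c : Fin n →₀ ℕ, ∑ i, c i = ∑ i, c i % 2 + 2 * ∑ i, c i / 2 := by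
      intro c
      rw [Finset.mul_sum, ← Finset.sum_add_distrib]
      exact Finset.sum_congr rfl fun i _ => (Nat.mod_add_div _ _).symm
    have e2 : ∑ i, a i % 2 = ∑ i, b i % 2 := Finset.sum_congr rfl fun i _ => hmod i
    have e3 := e1 a
    have e4 := e1 b
    omega
  simp only [hmod, hdiv]

lemma mem_of_forall_monomial_sub_mem {J : Ideal (MvPolynomial G.edgeSet K)}
    (hJ : ∀ α β, SameClass G α β → (monomial α 1 - monomial β 1 : MvPolynomial G.edgeSet K) ∈ J)
    {f : MvPolynomial G.edgeSet K} (hf : f ∈ eulerianIdeal K G) : f ∈ J := by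
  classical
  have hC : ∀ (α : G.edgeSet →₀ ℕ) (c : K), monomial α c = C c * monomial α 1 := by
    intro α c
    rw [C_mul_monomial, mul_one]
  rw [← Ideal.Quotient.eq_zero_iff_mem, ← support_sum_monomial_coeff f, map_sum]
  set key : (G.edgeSet →₀ ℕ) → ℕ × (Fin n → ZMod 2) := fun α => (α.degree, bd G α) with hkey
  rw [← Finset.sum_fiberwise_of_maps_to (t := f.support.image key)
    fun α hα => Finset.mem_image_of_mem key hα]
  refine Finset.sum_eq_zero fun k hk => ?_
  obtain ⟨α, -, rfl⟩ := Finset.mem_image.1 hk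
  have h0 := sum_coeff_class_eq_zero hf α
  have : ∀ β ∈ f.support.filter (key · = key α), Ideal.Quotient.mk J (monomial β (coeff β f)) =
      Ideal.Quotient.mk J (C (coeff β f)) * Ideal.Quotient.mk J (monomial α 1) := by
    intro β hβ
    rw [hC, map_mul, Ideal.Quotient.eq.2 (hJ β α (Prod.ext_iff.1 (Finset.mem_filter.1 hβ).2))]
  rw [Finset.sum_congr rfl this, ← Finset.sum_mul, ← map_sum, ← map_sum]
  have h1 : (∑ β ∈ f.support with key β = key α, coeff β f) = 0 := by
    rw [← h0]
    refine Finset.sum_congr (Finset.filter_congr fun β _ => ?_) fun _ _ => rfl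
    simp [hkey, SameClass]
  rw [h1]
  simp

end Algebra

lemma exists_eq_add_single {ι : Type*} {α : ι →₀ ℕ} {k : ℕ} (h : α.degree = k + 1) :
    ∃ (e : ι) (γ : ι →₀ ℕ), α = γ + Finsupp.single e 1 ∧ γ.degree = k := by
  obtain ⟨e, he⟩ : ∃ e, α e ≠ 0 := by
    by_contra! h0
    have : α = 0 := Finsupp.ext h0
    simp [this] at h
  have hle : α - Finsupp.single e 1 + Finsupp.single e 1 = α :=
    tsub_add_cancel_of_le (by simpa [Nat.one_le_iff_ne_zero] using he)
  refine ⟨e, _, hle.symm, ?_⟩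
  have := congrArg Finsupp.degree hle
  simp only [map_add, Finsupp.degree_single] at this
  omega

lemma exists_eq_single {ι : Type*} {α : ι →₀ ℕ} (h : α.degree = 1) :
    ∃ e : ι, α = Finsupp.single e 1 := by
  obtain ⟨e, γ, rfl, hγ⟩ := exists_eq_add_single (k := 0) h
  rw [Finsupp.degree_eq_zero_iff] at hγ
  exact ⟨e, by simp [hγ]⟩

lemma exists_eq_single_add_single {ι : Type*} {α : ι →₀ ℕ} (h : α.degree = 2) :
    ∃ e f : ι, α = Finsupp.single e 1 + Finsupp.single f 1 := by
  obtain ⟨e, γ, rfl, hγ⟩ := exists_eq_add_single (k := 1) h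
  obtain ⟨f, rfl⟩ := exists_eq_single hγ
  exact ⟨f, e, rfl⟩

lemma SameClass.eq_of_degree_le_one {G : SimpleGraph (Fin n)} {α β : G.edgeSet →₀ ℕ}
    (h : SameClass G β α) (hα : α.degree ≤ 1) : β = α := by
  obtain ⟨h1, h2⟩ := h
  rcases Nat.le_one_iff_eq_zero_or_eq_one.1 hα with h0 | h0
  · rw [h0] at h1
    rw [(Finsupp.degree_eq_zero_iff _).1 h0, (Finsupp.degree_eq_zero_iff _).1 h1]
  · obtain ⟨e, rfl⟩ := exists_eq_single h0
    obtain ⟨f, rfl⟩ := exists_eq_single (h1.trans h0)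
    simp only [bd_single, one_smul] at h2
    rw [Subtype.ext (edgeBd_injective h2)]

lemma perfect_matchings_of_four {V : Type*} {p p' q q' y₁ y₂ z₁ z₂ : V} (h1 : p ≠ p') (h2 : p ≠ q)
    (h3 : p ≠ q') (h4 : p' ≠ q) (h5 : p' ≠ q') (h6 : q ≠ q')
    (hp : p = y₁ ∨ p = y₂ ∨ p = z₁ ∨ p = z₂) (hp' : p' = y₁ ∨ p' = y₂ ∨ p' = z₁ ∨ p' = z₂)
    (hq : q = y₁ ∨ q = y₂ ∨ q = z₁ ∨ q = z₂) (hq' : q' = y₁ ∨ q' = y₂ ∨ q' = z₁ ∨ q' = z₂) :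
    (s(y₁, y₂) = s(p, p') ∧ s(z₁, z₂) = s(q, q')) ∨ (s(y₁, y₂) = s(q, q') ∧ s(z₁, z₂) = s(p, p')) ∨
    (s(y₁, y₂) = s(p, q) ∨ s(z₁, z₂) = s(p, q)) ∨
    (s(y₁, y₂) = s(p', q) ∧ s(z₁, z₂) = s(p, q')) ∨
    (s(y₁, y₂) = s(p, q') ∧ s(z₁, z₂) = s(p', q)) := by
  simp only [Sym2.eq_iff]
  rcases hp with rfl | rfl | rfl | rfl <;> rcases hp' with rfl | rfl | rfl | rfl <;>
    first
    | contradiction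
    | (rcases hq with rfl | rfl | rfl | rfl <;>
        first
        | contradiction
        | (rcases hq' with rfl | rfl | rfl | rfl <;>
            first
            | contradiction
            | simp))

lemma pair_eq_pair_of_edgeBd_add_eq {G : SimpleGraph (Fin n)} {p p' q q' : Fin n}
    (h1 : p ≠ p') (h2 : p ≠ q) (h3 : p ≠ q') (h4 : p' ≠ q) (h5 : p' ≠ q') (h6 : q ≠ q')
    (hpq : ¬ G.Adj p q) (hcross : ¬ (G.Adj p' q ∧ G.Adj p q')) {c c' : Sym2 (Fin n)}
    (hc : c ∈ G.edgeSet) (hc' : c' ∈ G.edgeSet)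
    (h : edgeBd c + edgeBd c' = edgeBd s(p, p') + edgeBd s(q, q')) :
    (c = s(p, p') ∧ c' = s(q, q')) ∨ (c = s(q, q') ∧ c' = s(p, p')) := by
  have hmem : ∀ t, (edgeBd s(p, p') + edgeBd s(q, q')) t = 1 → t ∈ c ∨ t ∈ c' := by
    intro t ht
    rw [← h] at ht
    by_contra! hno
    simp [edgeBd, hno.1, hno.2] at ht
  have hp := hmem p (by simp [edgeBd, h1, h2, h3])
  have hp' := hmem p' (by simp [edgeBd, h4, h5])
  have hq := hmem q (by simp [edgeBd, h2.symm, h4.symm])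
  have hq' := hmem q' (by simp [edgeBd, h3.symm, h5.symm])
  induction c using Sym2.ind with
  | _ y₁ y₂ =>
  induction c' using Sym2.ind with
  | _ z₁ z₂ =>
  simp only [Sym2.mem_iff, or_assoc] at hp hp' hq hq'
  rcases perfect_matchings_of_four h1 h2 h3 h4 h5 h6 hp hp' hq hq' with
    h | h | (h | h) | ⟨h, h'⟩ | ⟨h, h'⟩
  · exact Or.inl h
  · exact Or.inr h
  · rw [h] at hc
    exact absurd hc hpq
  · rw [h] at hc'
    exact absurd hc' hpq
  · rw [h] at hc
    rw [h'] at hc'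
    exact absurd ⟨hc, hc'⟩ hcross
  · rw [h] at hc
    rw [h'] at hc'
    exact absurd ⟨hc', hc⟩ hcross

lemma sum_range_even_add_odd {M : Type*} [AddCommMonoid M] (g : ℕ → M) (d : ℕ) :
    ∑ i ∈ Finset.range d, (g (2 * i) + g (2 * i + 1)) = ∑ j ∈ Finset.range (2 * d), g j := by
  induction d with
  | zero => simp
  | succ d ih =>
    rw [Finset.sum_range_succ, ih, Nat.mul_succ, Finset.sum_range_succ, Finset.sum_range_succ,
      add_assoc]

/-- A chordless cycle of length `2 * d ≥ 6` yields a squarefree class of size `d` with at least two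
members, one of which has no divisor of degree at most two lying in a nontrivial class. -/
lemma exists_isolated_of_chordless {G : SimpleGraph (Fin n)} (hbip : G.Colorable 2)
    {C : Finset G.edgeSet} (hC : IsCycleSet G C) (hcard : 4 < C.card)
    (hno : ¬ ∃ l : G.edgeSet, IsChord G C l) :
    ∃ α β : G.edgeSet →₀ ℕ, SameClass G α β ∧ α ≠ β ∧
      ∀ δ ≤ α, δ.degree ≤ 2 → ∀ γ, SameClass G γ δ → γ = δ := by
  classical
  obtain ⟨v, w, hw, hCw⟩ := hC
  have hmemC : ∀ e : G.edgeSet, e ∈ C ↔ e.1 ∈ w.edges := by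
    intro e
    rw [← List.mem_toFinset, ← hCw, Finset.mem_image]
    exact ⟨fun h => ⟨e, h, rfl⟩, by rintro ⟨f, hf, h⟩; rwa [← Subtype.ext h]⟩
  have hCe : C = edgesIn G w.edges := by
    ext e
    rw [hmemC, mem_edgesIn]
  have hwG : ∀ e ∈ w.edges, e ∈ G.edgeSet := fun e he => w.edges_subset_edgeSet he
  have hEul : ∑ e ∈ C, edgeBd e.1 = 0 := by
    rw [hCe, sum_edgesIn hw.edges_nodup hwG, sum_edgeBd_walk, zmodTwo_fun_add_self]
  have hlen : C.card = w.length := by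
    rw [hCe, card_edgesIn hw.edges_nodup hwG, SimpleGraph.Walk.length_edges]
  obtain ⟨d, hd⟩ := even_card_of_sum_edgeBd_eq_zero hbip hEul
  have hwd : w.length = 2 * d := by omega
  have hd3 : 3 ≤ d := by omega
  set x : ℕ → Fin n := w.getVert with hx
  have hx0 : x (2 * d) = x 0 := by
    rw [hx, ← hwd]
    simp
  have hinj : ∀ i < 2 * d, ∀ j < 2 * d, x i = x j → i = j := by
    intro i hi j hj h
    exact hw.getVert_injOn' (by simp only [Set.mem_ofPred_eq]; omega)
      (by simp only [Set.mem_ofPred_eq]; omega) h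
  have hadj : ∀ i < 2 * d, G.Adj (x i) (x (i + 1)) := fun i hi => w.adj_getVert_succ (by omega)
  have hedge : ∀ i < 2 * d, s(x i, x (i + 1)) ∈ w.edges := fun i hi =>
    (w.mk_mem_edges_iff_exists).2 ⟨i, by omega, rfl⟩
  have hvert : ∀ i < 2 * d, x i ∈ edgeVerts G C := by
    intro i hi
    simp only [edgeVerts, Finset.mem_filter, Finset.mem_univ, true_and]
    exact ⟨⟨_, hadj i hi⟩, (hmemC _).2 (hedge i hi), by simp⟩
  have hadj_iff : ∀ i < 2 * d, ∀ j < 2 * d, G.Adj (x i) (x j) →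
      j = i + 1 ∨ i = j + 1 ∨ (i = 0 ∧ j + 1 = 2 * d) ∨ (j = 0 ∧ i + 1 = 2 * d) := by
    intro i hi j hj hij
    have hmem : s(x i, x j) ∈ w.edges := by
      by_contra hnot
      refine hno ⟨⟨s(x i, x j), hij⟩, fun h => hnot ((hmemC _).1 h), fun t ht => ?_⟩
      rcases Sym2.mem_iff.1 ht with rfl | rfl
      · exact hvert i hi
      · exact hvert j hj
    obtain ⟨k, hk, hkk⟩ := (w.mk_mem_edges_iff_exists).1 hmem
    have hk' : k < 2 * d := by omega
    have hsucc : ∀ m < 2 * d, x (k + 1) = x m → m = k + 1 ∨ (m = 0 ∧ k + 1 = 2 * d) := by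
      intro m hm h
      rcases Nat.lt_or_ge (k + 1) (2 * d) with hlt | hge
      · exact Or.inl (hinj _ hlt _ hm h).symm
      · have hk2 : k + 1 = 2 * d := by omega
        rw [hk2, hx0] at h
        exact Or.inr ⟨(hinj 0 (by omega) _ hm h).symm, hk2⟩
    rcases Sym2.eq_iff.1 hkk with ⟨h1, h2⟩ | ⟨h1, h2⟩
    · have := hinj _ hk' _ hi h1
      have := hsucc _ hj h2
      omega
    · have := hinj _ hk' _ hj h1
      have := hsucc _ hi h2
      omega
  have hne : ∀ i < 2 * d, ∀ j < 2 * d, i ≠ j → x i ≠ x j :=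
    fun i hi j hj hij h => hij (hinj i hi j hj h)
  have hedge_inj : ∀ i < 2 * d, ∀ j < 2 * d, s(x i, x (i + 1)) = s(x j, x (j + 1)) → i = j := by
    intro i hi j hj h
    have hi' := hedge i hi
    have hnd := hw.edges_nodup
    rw [List.nodup_iff_injective_get] at hnd
    have hget : ∀ k (hk : k < 2 * d), w.edges.get ⟨k, by simp; omega⟩ = s(x k, x (k + 1)) := by
      intro k hk
      simp [SimpleGraph.Walk.getElem_edges, hx]
    have := hnd ((hget i hi).trans (h.trans (hget j hj).symm))
    simpa using this
  set ev : ℕ → G.edgeSet := fun i => if h : i < 2 * d then ⟨s(x i, x (i + 1)), hadj i h⟩ else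
    ⟨s(x 0, x 1), hadj 0 (by omega)⟩ with hev
  have hev1 : ∀ i < 2 * d, (ev i).1 = s(x i, x (i + 1)) := by
    intro i hi
    simp [hev, hi]
  have hev_inj : ∀ i < 2 * d, ∀ j < 2 * d, ev i = ev j → i = j := by
    intro i hi j hj h
    refine hedge_inj i hi j hj ?_
    rw [← hev1 i hi, ← hev1 j hj, h]
  have hpair : ∀ p < d, ∀ q < d, p < q → ∀ c c' : G.edgeSet,
      edgeBd c.1 + edgeBd c'.1 = edgeBd (ev (2 * p)).1 + edgeBd (ev (2 * q)).1 →
      (c = ev (2 * p) ∧ c' = ev (2 * q)) ∨ (c = ev (2 * q) ∧ c' = ev (2 * p)) := by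
    intro p hp q hq hpq c c' h
    have e1 := hev1 (2 * p) (by omega)
    have e2 := hev1 (2 * q) (by omega)
    rw [e1, e2] at h
    simp only [Subtype.ext_iff, e1, e2]
    refine pair_eq_pair_of_edgeBd_add_eq (hne _ ?_ _ ?_ ?_) (hne _ ?_ _ ?_ ?_) (hne _ ?_ _ ?_ ?_)
      (hne _ ?_ _ ?_ ?_) (hne _ ?_ _ ?_ ?_) (hne _ ?_ _ ?_ ?_) (fun hA => ?_) (fun hA => ?_)
      c.2 c'.2 h
    any_goals omega
    · have := hadj_iff _ (by omega) _ (by omega) hA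
      omega
    · have h1 := hadj_iff _ (by omega) _ (by omega) hA.1
      have h2 := hadj_iff _ (by omega) _ (by omega) hA.2
      omega
  set A := (Finset.range d).image fun i => ev (2 * i) with hA
  set B := (Finset.range d).image fun i => ev (2 * i + 1) with hB
  have hAinj : Set.InjOn (fun i => ev (2 * i)) (Finset.range d) := by
    intro i hi j hj h
    simp only [Finset.coe_range, Set.mem_Iio] at hi hj
    have := hev_inj _ (by omega) _ (by omega) h
    omega
  have hBinj : Set.InjOn (fun i => ev (2 * i + 1)) (Finset.range d) := by
    intro i hi j hj h
    simp only [Finset.coe_range, Set.mem_Iio] at hi hj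
    have := hev_inj _ (by omega) _ (by omega) h
    omega
  refine ⟨∑ e ∈ A, Finsupp.single e 1, ∑ e ∈ B, Finsupp.single e 1, ⟨?_, ?_⟩, ?_, ?_⟩
  · rw [degree_indicator, degree_indicator, hA, hB, Finset.card_image_of_injOn hAinj,
      Finset.card_image_of_injOn hBinj]
  · rw [bd_indicator, bd_indicator, hA, hB, Finset.sum_image hAinj, Finset.sum_image hBinj]
    have h1 : ∀ i ∈ Finset.range d, edgeBd (ev (2 * i)).1 =
        Pi.single (x (2 * i)) 1 + Pi.single (x (2 * i + 1)) 1 := by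
      intro i hi
      have hi := Finset.mem_range.1 hi
      rw [hev1 _ (by omega), edgeBd_mk (hadj _ (by omega)).ne]
    have h2 : ∀ i ∈ Finset.range d, edgeBd (ev (2 * i + 1)).1 =
        Pi.single (x (2 * i + 1)) 1 + Pi.single (x (2 * i + 1 + 1)) 1 := by
      intro i hi
      have hi := Finset.mem_range.1 hi
      rw [hev1 _ (by omega), edgeBd_mk (hadj _ (by omega)).ne]
    rw [Finset.sum_congr rfl h1, Finset.sum_congr rfl h2,
      sum_range_even_add_odd (fun j => (Pi.single (x j) 1 : Fin n → ZMod 2)),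
      sum_range_even_add_odd (fun j => (Pi.single (x (j + 1)) 1 : Fin n → ZMod 2))]
    have h3 := Finset.sum_range_succ' (fun j => (Pi.single (x j) 1 : Fin n → ZMod 2)) (2 * d)
    rw [Finset.sum_range_succ, hx0] at h3
    exact add_right_cancel h3
  · intro heq
    have h0 := DFunLike.congr_fun heq (ev 0)
    rw [indicator_apply, indicator_apply, if_pos, if_neg] at h0
    · exact one_ne_zero h0
    · rw [hB, Finset.mem_image]
      rintro ⟨i, hi, h⟩
      have hi := Finset.mem_range.1 hi
      have := hev_inj _ (by omega) _ (by omega) h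
      omega
    · exact Finset.mem_image.2 ⟨0, Finset.mem_range.2 (by omega), rfl⟩
  · intro δ hδ hδ2 γ hγ
    rcases Nat.lt_or_ge δ.degree 2 with hlt | hge
    · exact hγ.eq_of_degree_le_one (by omega)
    have hδ2 : δ.degree = 2 := by omega
    obtain ⟨e, f, rfl⟩ := exists_eq_single_add_single hδ2
    obtain ⟨c, c', rfl⟩ := exists_eq_single_add_single (hγ.1.trans hδ2)
    have he := hδ e
    have hf := hδ f
    rw [indicator_apply] at he hf
    simp only [Finsupp.add_apply, Finsupp.single_apply, if_true] at he hf
    have heA : e ∈ A := by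
      by_contra h
      rw [if_neg h] at he
      omega
    have hfA : f ∈ A := by
      by_contra h
      rw [if_neg h] at hf
      omega
    have hef : f ≠ e := by
      intro h
      rw [if_pos h, if_pos heA] at he
      omega
    have hbd := hγ.2
    simp only [map_add, bd_single, one_smul] at hbd
    obtain ⟨p, hp, rfl⟩ := Finset.mem_image.1 heA
    obtain ⟨q, hq, rfl⟩ := Finset.mem_image.1 hfA
    have hp := Finset.mem_range.1 hp
    have hq := Finset.mem_range.1 hq
    rcases lt_trichotomy p q with hlt | rfl | hlt
    · rcases hpair p hp q hq hlt c c' hbd with ⟨rfl, rfl⟩ | ⟨rfl, rfl⟩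
      · rfl
      · exact add_comm _ _
    · exact absurd rfl hef
    · rcases hpair q hq p hp hlt c c' (hbd.trans (add_comm _ _)) with ⟨rfl, rfl⟩ | ⟨rfl, rfl⟩
      · exact add_comm _ _
      · rfl

section MinimalGenerators

variable {σ K : Type*} [Field K]

attribute [local instance] MvPolynomial.gradedAlgebra

lemma homogeneousComponent_mem_span {S : Set (MvPolynomial σ K)}
    (hS : ∀ f ∈ S, ∃ d : ℕ, f.IsHomogeneous d) {u : MvPolynomial σ K} (hu : u ∈ Ideal.span S)
    (d : ℕ) : homogeneousComponent d u ∈ Ideal.span S :=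
  homogeneousComponent_mem_of_mem (Ideal.homogeneous_span _ _ fun f hf => hS f hf) hu d

lemma totalDegree_le_of_le_span {S : Set (MvPolynomial σ K)} {I : Ideal (MvPolynomial σ K)}
    (hS : IsMinimalHomGenSet S I) {d : ℕ}
    (hI : I ≤ Ideal.span {f | f ∈ I ∧ f.IsHomogeneous d}) {f : MvPolynomial σ K} (hf : f ∈ S) :
    f.totalDegree ≤ d := by
  classical
  obtain ⟨hhom, hspan, hmin⟩ := hS
  by_contra hlt
  obtain ⟨m, hm⟩ := hhom f hf
  have hdm : d < m := (not_le.1 hlt).trans_le hm.totalDegree_le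
  refine hmin f hf (le_antisymm (hspan ▸ Ideal.span_mono Set.sdiff_subset) (hI.trans ?_))
  rw [Ideal.span_le]
  rintro g ⟨hgI, hg⟩
  rw [← hspan, ← Set.insert_sdiff_self_of_mem hf, Ideal.mem_span_insert] at hgI
  obtain ⟨c, u, hu, rfl⟩ := hgI
  have h0 : homogeneousComponent d (c * f) = 0 := by
    ext α
    rw [coeff_homogeneousComponent, coeff_zero]
    split_ifs with hα
    · rw [coeff_mul]
      refine Finset.sum_eq_zero fun x hx => ?_
      have hx' := congrArg Finsupp.degree (Finset.HasAntidiagonal.mem_antidiagonal.1 hx)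
      rw [map_add] at hx'
      rw [hm.coeff_eq_zero (by omega), mul_zero]
    · rfl
  have h1 : homogeneousComponent d (c * f + u) = c * f + u := by
    rw [homogeneousComponent_of_mem hg, if_pos rfl]
  rw [map_add, h0, zero_add] at h1
  rw [← h1]
  exact homogeneousComponent_mem_span (fun f hf => hhom f hf.1) hu d

lemma coeff_eq_zero_of_mem_span {S : Set (MvPolynomial σ K)} {α : σ →₀ ℕ}
    (hS : ∀ s ∈ S, ∀ δ ≤ α, coeff δ s = 0) {f : MvPolynomial σ K} (hf : f ∈ Ideal.span S) :
    coeff α f = 0 := by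
  classical
  have key : ∀ c : MvPolynomial σ K, coeff α (c * f) = 0 := by
    induction hf using Submodule.span_induction with
    | mem s hs =>
      intro c
      rw [coeff_mul]
      refine Finset.sum_eq_zero fun x hx => ?_
      have hx := Finset.HasAntidiagonal.mem_antidiagonal.1 hx
      rw [hS s hs x.2 (le_add_self.trans_eq hx), mul_zero]
    | zero => simp
    | add f g _ _ hf hg => exact fun c => by rw [mul_add, coeff_add, hf, hg, add_zero]
    | smul a f _ hf => exact fun c => by rw [smul_eq_mul, ← mul_assoc, hf]
  simpa using key 1

end MinimalGenerators

section EulerianIdeal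

variable {K : Type*} [Field K] {G : SimpleGraph (Fin n)}

lemma eulerianIdeal_le_span_degree_two (hbip : G.Colorable 2)
    (hch : ∀ C : Finset G.edgeSet, IsCycleSet G C → 4 < C.card → ∃ l, IsChord G C l) :
    eulerianIdeal K G ≤ Ideal.span {f | f ∈ eulerianIdeal K G ∧ f.IsHomogeneous 2} := by
  set J := Ideal.span {f | f ∈ eulerianIdeal K G ∧ f.IsHomogeneous 2}
  have hR : Equivalence fun α β : G.edgeSet →₀ ℕ =>
      (monomial α 1 - monomial β 1 : MvPolynomial G.edgeSet K) ∈ J :=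
    { refl := fun α => by simp
      symm := fun h => by simpa using J.neg_mem h
      trans := fun h h' => by simpa using J.add_mem h h' }
  refine fun f hf => mem_of_forall_monomial_sub_mem
    (fun α β h => rel_of_sameClass hbip hch hR ?_ ?_ h) hf
  · intro α β γ h
    have := J.mul_mem_right (monomial γ 1) h
    rwa [sub_mul, monomial_mul, monomial_mul, one_mul] at this
  · intro α β h h2
    exact Ideal.subset_span ⟨monomial_sub_monomial_mem h,
      (isHomogeneous_monomial _ h2).sub (isHomogeneous_monomial _ (h.1 ▸ h2))⟩

lemma two_le_totalDegree {f : MvPolynomial G.edgeSet K} (hf : f ∈ eulerianIdeal K G)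
    (h0 : f ≠ 0) : 2 ≤ f.totalDegree := by
  obtain ⟨α, hα⟩ := ne_zero_iff.1 h0
  by_contra hlt
  have := le_totalDegree (mem_support_iff.2 hα)
  refine hα (coeff_eq_zero_of_unique hf fun β hβ => hβ.eq_of_degree_le_one ?_)
  change α.degree ≤ _ at this
  omega

lemma eulerianIdeal_ne_bot (hE : 2 ≤ G.edgeSet.ncard) : eulerianIdeal K G ≠ ⊥ := by
  obtain ⟨e, he, f, hf, hef⟩ := (Set.one_lt_ncard (Set.toFinite _)).1 hE
  intro hbot
  have h := monomial_sub_monomial_mem (K := K)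
    (sameClass_single_two (⟨e, he⟩ : G.edgeSet) ⟨f, hf⟩)
  rw [hbot, Ideal.mem_bot, sub_eq_zero] at h
  have h1 := monomial_left_injective (one_ne_zero (α := K)) h
  have h2 := Finsupp.single_left_injective two_ne_zero h1
  exact hef (congrArg Subtype.val h2)

end EulerianIdeal

/-- if `G` is bipartite, then `d(I(G)) = 2` iff `G` is bipartite chordal,
i.e. every cycle of `G` of length greater than `4` has a chord. -/
theorem stmt11 {n : ℕ} (K : Type*) [Field K] (G : SimpleGraph (Fin n))
    (hE : 2 ≤ G.edgeSet.ncard) (hbip : G.Colorable 2)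
    (S : Set (MvPolynomial G.edgeSet K))
    (hS : IsMinimalHomGenSet S (eulerianIdeal K G)) :
    sSup ((fun f : MvPolynomial G.edgeSet K => f.totalDegree) '' S) = 2 ↔
      ∀ C : Finset G.edgeSet, IsCycleSet G C → 4 < C.card →
        ∃ l : G.edgeSet, IsChord G C l := by
  constructor
  · intro hsup C hC hcard
    by_contra hno
    obtain ⟨α, β, hαβ, hne, hiso⟩ :=
      exists_isolated_of_chordless hbip hC hcard hno
    have hbdd : BddAbove ((fun f : MvPolynomial G.edgeSet K => f.totalDegree) '' S) := by
      by_contra h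
      rw [Nat.sSup_of_not_bddAbove h] at hsup
      omega
    have hdeg : ∀ f ∈ S, f.totalDegree ≤ 2 := fun f hf =>
      hsup ▸ le_csSup hbdd (Set.mem_image_of_mem _ hf)
    have hmem := monomial_sub_monomial_mem (K := K) hαβ
    rw [← hS.2.1] at hmem
    have h0 := coeff_eq_zero_of_mem_span (α := α) (fun s hs δ hδ => ?_) hmem
    · rw [coeff_sub, coeff_monomial, coeff_monomial, if_pos rfl, if_neg hne.symm, sub_zero] at h0
      exact one_ne_zero h0
    · rcases le_or_gt δ.degree 2 with h2 | h2
      · exact coeff_eq_zero_of_unique (hS.2.1 ▸ Ideal.subset_span hs) (hiso δ hδ h2)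
      · exact coeff_eq_zero_of_totalDegree_lt ((hdeg s hs).trans_lt h2)
  · intro hch
    have hle : ∀ f ∈ S, f.totalDegree ≤ 2 := fun f hf =>
      totalDegree_le_of_le_span hS (eulerianIdeal_le_span_degree_two hbip hch) hf
    obtain ⟨f, hf, hf0⟩ : ∃ f ∈ S, f ≠ 0 := by
      by_contra! h
      exact eulerianIdeal_ne_bot hE (hS.2.1 ▸ Ideal.span_eq_bot.2 h)
    have hfI : f ∈ eulerianIdeal K G := hS.2.1 ▸ Ideal.subset_span hf
    refine IsGreatest.csSup_eq ⟨⟨f, hf, (hle f hf).antisymm (two_le_totalDegree hfI hf0)⟩, ?_⟩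
    rintro _ ⟨g, hg, rfl⟩
    exact hle g hg
end

section
/- Let C ⊆ E_G be the union of two odd cycles of G that are vertex-disjoint. Then C has an even-chord if and only if at least one of the two odd cycles has a chord. -/
open MvPolynomial Finset

variable {n : ℕ}

/-- The degree of a vertex in the edge set of a trail, as a count along the trail. -/
lemma degIn_eq_countP {G : SimpleGraph (Fin n)} {P : Finset G.edgeSet} {u v : Fin n}
    {p : G.Walk u v} (hp : p.IsTrail)
    (hP : P.image (fun e => e.val) = p.edges.toFinset) (i : Fin n) :
    degIn G P i = p.edges.countP (fun e => i ∈ e) := by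
  rw [degIn, ← card_image_of_injective _ (Subtype.val_injective (p := (· ∈ G.edgeSet))),
    List.countP_eq_length_filter, ← List.toFinset_card_of_nodup (hp.edges_nodup.filter _)]
  congr 1
  ext e
  have := Finset.ext_iff.1 hP e
  simp only [mem_image, List.mem_toFinset, mem_filter, List.mem_filter, decide_eq_true_eq] at this ⊢
  rw [← this]
  constructor
  · rintro ⟨x, ⟨hx, hi⟩, rfl⟩
    exact ⟨⟨x, hx, rfl⟩, hi⟩
  · rintro ⟨⟨x, hx, rfl⟩, hi⟩
    exact ⟨x, ⟨hx, hi⟩, rfl⟩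

lemma IsCycleSet.isEulerianSet {G : SimpleGraph (Fin n)} {C : Finset G.edgeSet}
    (h : IsCycleSet G C) : IsEulerianSet G C := by
  obtain ⟨v, w, hw, hC⟩ := h
  intro i
  rw [degIn_eq_countP hw.isTrail hC, hw.isTrail.even_countP_edges_iff]
  exact fun h => absurd rfl h

lemma mem_edgeVerts {G : SimpleGraph (Fin n)} {C : Finset G.edgeSet} {i : Fin n} :
    i ∈ edgeVerts G C ↔ ∃ e ∈ C, i ∈ e.val := by
  simp [edgeVerts]

/-- Two distinct vertices of a cycle are joined by a path inside the cycle. -/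
lemma IsCycleSet.exists_subset_odd_degIn_iff {G : SimpleGraph (Fin n)} {C : Finset G.edgeSet}
    (h : IsCycleSet G C) {a b : Fin n} (hab : a ≠ b) (ha : a ∈ edgeVerts G C)
    (hb : b ∈ edgeVerts G C) :
    ∃ P ⊆ C, ∀ i, Odd (degIn G P i) ↔ i = a ∨ i = b := by
  obtain ⟨v, w, hw, hC⟩ := h
  have hmem : ∀ {i}, i ∈ edgeVerts G C → i ∈ w.support := by
    intro i hi
    obtain ⟨e, he, hie⟩ := mem_edgeVerts.1 hi
    have hew : e.val ∈ w.edges := by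
      rw [← List.mem_toFinset, ← hC]
      exact mem_image_of_mem _ he
    exact w.mem_support_of_mem_edges hew hie
  have haw := hmem ha
  have hbw : b ∈ (w.rotate a haw).support := (w.mem_support_rotate_iff a haw).2 (hmem hb)
  set p := (w.rotate a haw).takeUntil b hbw
  have hp : p.IsTrail := (hw.rotate haw).isTrail.takeUntil hbw
  have hpw : ∀ e ∈ p.edges, e ∈ w.edges := fun e he =>
    (w.rotate_edges a haw).mem_iff.1 ((w.rotate a haw).edges_takeUntil_subset_edges hbw he)
  refine ⟨C.filter (fun e => e.val ∈ p.edges), filter_subset _ _, fun i => ?_⟩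
  rw [degIn_eq_countP hp, ← Nat.not_even_iff_odd, hp.even_countP_edges_iff]
  · tauto
  · ext e
    have := Finset.ext_iff.1 hC e
    simp only [mem_image, List.mem_toFinset, mem_filter] at this ⊢
    constructor
    · rintro ⟨x, ⟨-, hx⟩, rfl⟩
      exact hx
    · intro he
      obtain ⟨x, hx, rfl⟩ := this.2 (hpw e he)
      exact ⟨x, ⟨hx, he⟩, rfl⟩

lemma degIn_union {G : SimpleGraph (Fin n)} {A B : Finset G.edgeSet} (h : Disjoint A B)
    (i : Fin n) : degIn G (A ∪ B) i = degIn G A i + degIn G B i := by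
  rw [degIn, filter_union, card_union_of_disjoint (disjoint_filter_filter h)]
  rfl

lemma degIn_insert {G : SimpleGraph (Fin n)} {A : Finset G.edgeSet} {l : G.edgeSet} (h : l ∉ A)
    (i : Fin n) : degIn G (insert l A) i = degIn G A i + if i ∈ l.val then 1 else 0 := by
  rw [degIn, filter_insert]
  split_ifs with hi
  · rw [card_insert_of_notMem (by simp [h])]
    rfl
  · rfl

lemma degIn_sdiff_add {G : SimpleGraph (Fin n)} {A C : Finset G.edgeSet} (h : A ⊆ C)
    (i : Fin n) : degIn G (C \ A) i + degIn G A i = degIn G C i := by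
  rw [← degIn_union sdiff_disjoint, sdiff_union_of_subset h]

/-- The handshake lemma for edge sets. -/
lemma even_sum_degIn {G : SimpleGraph (Fin n)} (A : Finset G.edgeSet) :
    Even (∑ i, degIn G A i) := by
  induction A using Finset.induction_on with
  | empty => simp [degIn]
  | insert l A hl ih =>
    simp only [degIn_insert hl, sum_add_distrib]
    refine ih.add ?_
    obtain ⟨e, he⟩ := l
    induction e with
    | _ a b =>
      have hab : a ≠ b := G.ne_of_adj he
      have : (univ.filter fun i => i ∈ s(a, b)) = {a, b} := by
        ext i
        simp
      rw [← card_filter, this, card_pair hab]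
      exact even_two

lemma degIn_eq_zero {G : SimpleGraph (Fin n)} {A : Finset G.edgeSet} {i : Fin n}
    (h : i ∉ edgeVerts G A) : degIn G A i = 0 := by
  rw [degIn, card_eq_zero, filter_eq_empty_iff]
  exact fun e he hi => h (mem_edgeVerts.2 ⟨e, he, hi⟩)

lemma edgeVerts_mono {G : SimpleGraph (Fin n)} {A B : Finset G.edgeSet} (h : A ⊆ B) :
    edgeVerts G A ⊆ edgeVerts G B := fun _ hi =>
  let ⟨e, he, hie⟩ := mem_edgeVerts.1 hi
  mem_edgeVerts.2 ⟨e, h he, hie⟩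

lemma disjoint_of_disjoint_edgeVerts {G : SimpleGraph (Fin n)} {A B : Finset G.edgeSet}
    (h : Disjoint (edgeVerts G A) (edgeVerts G B)) : Disjoint A B := by
  refine Finset.disjoint_left.2 fun e hA hB => ?_
  have he := e.val.out_fst_mem
  exact Finset.disjoint_left.1 h (mem_edgeVerts.2 ⟨e, hA, he⟩) (mem_edgeVerts.2 ⟨e, hB, he⟩)

/-- An odd set of edges of `C` whose odd degree vertices are the ends of `l ∉ C` makes `l` an
even-chord of `C`. -/
lemma isEvenChord_of_subset {G : SimpleGraph (Fin n)} {A C : Finset G.edgeSet} {l : G.edgeSet}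
    (hl : l ∉ C) (hC : IsEulerianSet G C) (hCe : Even C.card) (hA : A ⊆ C) (hAo : Odd A.card)
    (hdeg : ∀ i, Odd (degIn G A i) ↔ i ∈ l.val) : IsEvenChord G C l := by
  have hlA : l ∉ A := fun h => hl (hA h)
  have hlB : l ∉ C \ A := fun h => hl (mem_sdiff.1 h).1
  refine ⟨hl, insert l A, insert l (C \ A), fun i => ?_, ?_, fun i => ?_, ?_, ?_, ?_⟩
  · rw [degIn_insert hlA]
    have := hdeg i
    grind
  · rw [card_insert_of_notMem hlA]
    exact hAo.add_one
  · rw [degIn_insert hlB]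
    have h1 := hdeg i
    have h2 := degIn_sdiff_add hA i
    have h3 := hC i
    grind
  · rw [card_insert_of_notMem hlB]
    have := card_sdiff_add_card_eq_card hA
    grind
  · ext x
    simp only [mem_inter, mem_insert, mem_sdiff, mem_singleton]
    tauto
  · ext x
    have := @hA x
    by_cases hx : x = l
    · subst hx
      simp [mem_symmDiff, hl]
    · simp only [mem_symmDiff, mem_insert, mem_sdiff, hx, false_or]
      tauto

/-- A chord of an odd cycle `D ⊆ C` is an even-chord of the even Eulerian set `C`. -/
lemma IsChord.isEvenChord {G : SimpleGraph (Fin n)} {C D : Finset G.edgeSet} {l : G.edgeSet}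
    (hl : IsChord G D l) (hD : IsCycleSet G D) (hDo : Odd D.card) (hDC : D ⊆ C) (hlC : l ∉ C)
    (hC : IsEulerianSet G C) (hCe : Even C.card) : IsEvenChord G C l := by
  obtain ⟨a, b, hab, hmem⟩ : ∃ a b, a ≠ b ∧ ∀ i, i ∈ l.val ↔ i = a ∨ i = b := by
    obtain ⟨e, he⟩ := l
    induction e with
    | _ a b => exact ⟨a, b, G.ne_of_adj he, fun i => Sym2.mem_iff⟩
  obtain ⟨P, hPD, hP⟩ := hD.exists_subset_odd_degIn_iff hab (hl.2 a (by simp [hmem]))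
    (hl.2 b (by simp [hmem]))
  by_cases hPo : Odd P.card
  · exact isEvenChord_of_subset hlC hC hCe (hPD.trans hDC) hPo fun i => by rw [hP, hmem]
  · refine isEvenChord_of_subset (A := D \ P) hlC hC hCe (sdiff_subset.trans hDC) ?_ fun i => ?_
    · have := card_sdiff_add_card_eq_card hPD
      grind
    · rw [hmem, ← hP]
      have h1 := degIn_sdiff_add hPD i
      have h2 := hD.isEulerianSet i
      grind

/-- If an edge set splits into vertex-disjoint parts `A` and `B`, and its odd degree vertices are
the ends of the edge `l`, then both ends of `l` lie in `A` as soon as one does. -/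
lemma mem_edgeVerts_of_odd_degIn_iff {G : SimpleGraph (Fin n)} {A B : Finset G.edgeSet}
    {l : G.edgeSet} (hAB : Disjoint (edgeVerts G A) (edgeVerts G B))
    (hdeg : ∀ i, Odd (degIn G (A ∪ B) i) ↔ i ∈ l.val) {a : Fin n} (hal : a ∈ l.val)
    (ha : a ∈ edgeVerts G A) : ∀ i ∈ l.val, i ∈ edgeVerts G A := by
  intro b hbl
  by_contra hb
  have hab : a ≠ b := fun h => hb (h ▸ ha)
  have hl : l.val = s(a, b) := (Sym2.mem_and_mem_iff hab).1 ⟨hal, hbl⟩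
  have hodd : ∀ i, Odd (degIn G A i) ↔ i = a := by
    intro i
    by_cases hi : i ∈ edgeVerts G A
    · have h := hdeg i
      rw [degIn_union (disjoint_of_disjoint_edgeVerts hAB),
        degIn_eq_zero (Finset.disjoint_left.1 hAB hi), add_zero, hl, Sym2.mem_iff] at h
      rw [h]
      exact or_iff_left fun hib => hb (hib ▸ hi)
    · rw [degIn_eq_zero hi]
      simp only [Nat.not_odd_zero, false_iff]
      exact fun hia => hi (hia ▸ ha)
  have hsum := even_sum_degIn A
  rw [Finset.even_sum_iff_even_card_odd] at hsum
  simp [hodd, filter_eq'] at hsum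

/-- if `C` is the union of two vertex-disjoint odd cycles of `G`, then `C`
has an even-chord iff at least one of the two odd cycles has a chord. -/
theorem stmt12 {n : ℕ} (G : SimpleGraph (Fin n)) (hE : 2 ≤ G.edgeSet.ncard)
    (C C₁ C₂ : Finset G.edgeSet)
    (h₁ : IsCycleSet G C₁) (ho₁ : Odd C₁.card)
    (h₂ : IsCycleSet G C₂) (ho₂ : Odd C₂.card)
    (hvd : Disjoint (edgeVerts G C₁) (edgeVerts G C₂)) (hC : C = C₁ ∪ C₂) :
    (∃ l : G.edgeSet, IsEvenChord G C l) ↔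
      (∃ l : G.edgeSet, IsChord G C₁ l) ∨ (∃ l : G.edgeSet, IsChord G C₂ l) := by
  classical
  subst hC
  have hd : Disjoint C₁ C₂ := disjoint_of_disjoint_edgeVerts hvd
  constructor
  · rintro ⟨l, hl, D₁, D₂, hD₁, -, -, -, hcap, hsymm⟩
    have hlD : l ∈ D₁ := (mem_inter.1 (hcap ▸ mem_singleton_self l)).1
    have hsub : D₁.erase l ⊆ C₁ ∪ C₂ := by
      intro x hx
      obtain ⟨hxl, hxD⟩ := mem_erase.1 hx
      rw [hsymm, mem_symmDiff]
      refine Or.inl ⟨hxD, fun hx2 => hxl ?_⟩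
      rw [← mem_singleton, ← hcap]
      exact mem_inter.2 ⟨hxD, hx2⟩
    set A := D₁.erase l ∩ C₁
    set B := D₁.erase l ∩ C₂
    have hAB : A ∪ B = D₁.erase l := by
      rw [← inter_union_distrib_left, inter_eq_left.2 hsub]
    have hA : edgeVerts G A ⊆ edgeVerts G C₁ := edgeVerts_mono inter_subset_right
    have hB : edgeVerts G B ⊆ edgeVerts G C₂ := edgeVerts_mono inter_subset_right
    have hdisj : Disjoint (edgeVerts G A) (edgeVerts G B) := hvd.mono hA hB
    have hdeg : ∀ i, Odd (degIn G (A ∪ B) i) ↔ i ∈ l.val := by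
      intro i
      have h1 := degIn_insert (notMem_erase l D₁) i
      rw [insert_erase hlD] at h1
      have h2 := hD₁ i
      rw [hAB]
      grind
    have hal := l.val.out_fst_mem
    have hpos := ((hdeg _).2 hal).pos
    rw [degIn_union (disjoint_of_disjoint_edgeVerts hdisj)] at hpos
    by_cases haA : l.val.out.1 ∈ edgeVerts G A
    · exact Or.inl ⟨l, fun h => hl (mem_union_left _ h), fun i hi =>
        hA (mem_edgeVerts_of_odd_degIn_iff hdisj hdeg hal haA i hi)⟩
    · have haB : l.val.out.1 ∈ edgeVerts G B := by
        by_contra haB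
        simp [degIn_eq_zero haA, degIn_eq_zero haB] at hpos
      rw [union_comm] at hdeg
      exact Or.inr ⟨l, fun h => hl (mem_union_right _ h), fun i hi =>
        hB (mem_edgeVerts_of_odd_degIn_iff hdisj.symm hdeg hal haB i hi)⟩
  · have hCE : IsEulerianSet G (C₁ ∪ C₂) := fun i => by
      rw [degIn_union hd]
      exact (h₁.isEulerianSet i).add (h₂.isEulerianSet i)
    have hCe : Even (C₁ ∪ C₂).card := by
      rw [card_union_of_disjoint hd]
      exact ho₁.add_odd ho₂
    have hal (l : G.edgeSet) := l.val.out_fst_mem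
    rintro (⟨l, hl⟩ | ⟨l, hl⟩)
    · refine ⟨l, hl.isEvenChord h₁ ho₁ subset_union_left (fun h => ?_) hCE hCe⟩
      exact Finset.disjoint_left.1 hvd (hl.2 _ (hal l))
        (mem_edgeVerts.2 ⟨l, (mem_union.1 h).resolve_left hl.1, hal l⟩)
    · refine ⟨l, hl.isEvenChord h₂ ho₂ subset_union_right (fun h => ?_) hCE hCe⟩
      exact Finset.disjoint_left.1 hvd
        (mem_edgeVerts.2 ⟨l, (mem_union.1 h).resolve_right hl.1, hal l⟩) (hl.2 _ (hal l))
end
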